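/- arXiv:2002.07558 — 10 statements merged into one kernel-verified Lean document; each statement's English description precedes it below -/
import Mathlib

section
/- The relation ⪯ is transitive: for all sets S₁, S₂, S₃ of origin graphs over finite alphabets Σ and Γ, if S₁ ⪯ S₂ and S₂ ⪯ S₃, then S₁ ⪯ S₃. -/
/-- An annotated letter over `Σ × {0,1}^(m+2)`: an input letter together with `m`
parameter bits and two marker bits (for the source position `x` and target position `y`). -/
abbrev RLetter (Sig : Type) (m : ℕ) : Type :=
  Sig × (Fin m → Bool) × Bool × Bool

/-- The word over `Σ × {0,1}^(m+2)` annotating `u` with the parameter valuation `Ī`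
(positions are 1-indexed, parameters given by their characteristic functions) and with
marker bits at positions `x` and `y`. -/
def annot {Sig : Type} {m : ℕ} (u : List Sig) (I : Fin m → ℕ → Bool)
    (x y : ℕ) : List (RLetter Sig m) :=
  u.mapIdx fun j a => (a, fun i => I i (j + 1), decide (j + 1 = x), decide (j + 1 = y))

/-- `(u, Ī, x, y) ⊨ γ`. -/
def RSat {Sig : Type} {m : ℕ} (γ : Set (List (RLetter Sig m)))
    (u : List Sig) (I : Fin m → ℕ → Bool) (x y : ℕ) : Prop :=
  annot u I x y ∈ γ

/-- A language is regular if it is accepted by a deterministic finite automaton. -/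
def IsRegularLang {α : Type} (L : Set (List α)) : Prop :=
  ∃ (Q : Type) (_ : Fintype Q) (M : DFA α Q), M.accepts = L

/-- A resynchronizer (given by its language `γ` with `m` input parameters) is bounded by `k`
if for every input word `u`, parameters `Ī` and position `y` of `u`, there are at most `k`
distinct positions `x` of `u` with `(u, Ī, x, y) ⊨ γ`. -/
def BoundedBy {Sig : Type} {m : ℕ} (γ : Set (List (RLetter Sig m))) (k : ℕ) : Prop :=
  ∀ (u : List Sig) (I : Fin m → ℕ → Bool) (y : ℕ), 1 ≤ y → y ≤ u.length →
    {x : ℕ | 1 ≤ x ∧ x ≤ u.length ∧ RSat γ u I x y}.ncard ≤ k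

/-- A resynchronizer is bounded if it is bounded by some `k`. -/
def BoundedResync {Sig : Type} {m : ℕ} (γ : Set (List (RLetter Sig m))) : Prop :=
  ∃ k, BoundedBy γ k

/-- An origin graph: a nonempty input word `u`, an output word `v`, and an origin map
sending every (1-indexed) position of `v` to a position of `u`. -/
structure OriginGraph (Sig Gam : Type) where
  inp : List Sig
  out : List Gam
  orig : ℕ → ℕ
  inp_ne : inp ≠ []
  orig_mem : ∀ t, 1 ≤ t → t ≤ out.length → 1 ≤ orig t ∧ orig t ≤ inp.length

/-- `(g, g') ∈ ⟦R⟧` for the resynchronizer with language `γ`: same input and output,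
and for some choice of input parameters, every output position has its `g`-origin
redirected to its `g'`-origin as allowed by `γ`. -/
def ResyncRel {Sig Gam : Type} {m : ℕ} (γ : Set (List (RLetter Sig m)))
    (g g' : OriginGraph Sig Gam) : Prop :=
  g.inp = g'.inp ∧ g.out = g'.out ∧
    ∃ I : Fin m → ℕ → Bool,
      ∀ z, 1 ≤ z → z ≤ g'.out.length → RSat γ g.inp I (g.orig z) (g'.orig z)

/-- `S₁ ⊆ R(S₂)` for the resynchronizer with language `γ`. -/
def ContainedUpTo {Sig Gam : Type} {m : ℕ} (γ : Set (List (RLetter Sig m)))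
    (S₁ S₂ : Set (OriginGraph Sig Gam)) : Prop :=
  ∀ g₁ ∈ S₁, ∃ g₂ ∈ S₂, ResyncRel γ g₂ g₁

/-- `S₁ ⪯ S₂`: there is a bounded regular resynchronizer `R` with `S₁ ⊆ R(S₂)`. -/
def ResyncLE {Sig Gam : Type} (S₁ S₂ : Set (OriginGraph Sig Gam)) : Prop :=
  ∃ (m : ℕ) (γ : Set (List (RLetter Sig m))),
    IsRegularLang γ ∧ BoundedResync γ ∧ ContainedUpTo γ S₁ S₂

/-- Input position `x` traverses input position `z` (with respect to the pair `(g, g')`). -/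
def Traverses {Sig Gam : Type} (g g' : OriginGraph Sig Gam) (x z : ℕ) : Prop :=
  ∃ t, 1 ≤ t ∧ t ≤ g.out.length ∧ g.orig t = x ∧
    ((x ≤ z ∧ z < g'.orig t) ∨ (g'.orig t < z ∧ z ≤ x))

/-- The pair `(g, g')` has `k`-traversal: every input position `z` is traversed by at
most `k` distinct positions. -/
def HasTraversal {Sig Gam : Type} (k : ℕ) (g g' : OriginGraph Sig Gam) : Prop :=
  ∀ z, 1 ≤ z → z ≤ g.inp.length → {x : ℕ | Traverses g g' x z}.ncard ≤ k


/-- The regular-language operation underlying first-order existential quantification: the words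
that admit a single marked position making the marked word belong to `A`. -/
def existsMark {α : Type} (A : Set (List (α × Bool))) : Set (List α) :=
  {l | ∃ c, 1 ≤ c ∧ c ≤ l.length ∧ l.mapIdx (fun j a => (a, decide (j + 1 = c))) ∈ A}

/-- A deterministic automaton for `existsMark M.accepts`: it tracks the states reached by `M` after
reading the input with one mark, together with the state reached without any mark. -/
def DFA.existsMark {α Q : Type} (M : DFA (α × Bool) Q) : DFA α (Set Q × Q) where
  step s a := ({q | (∃ p ∈ s.1, M.step p (a, false) = q) ∨ M.step s.2 (a, true) = q},
    M.step s.2 (a, false))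
  start := (∅, M.start)
  accept := {s | ∃ q ∈ s.1, q ∈ M.accept}

theorem mapIdx_mark_of_length_lt {α : Type} (l : List α) (c : ℕ) (hc : l.length < c) :
    l.mapIdx (fun j a => (a, decide (j + 1 = c))) = l.map fun a => (a, false) := by
  apply List.ext_getElem
  · simp
  · intro i h₁ h₂
    simp only [List.length_map] at h₂
    simp only [List.getElem_mapIdx, List.getElem_map, Prod.mk.injEq, decide_eq_false_iff_not,
      true_and]
    omega

theorem DFA.eval_existsMark {α Q : Type} (M : DFA (α × Bool) Q) (l : List α) :
    M.existsMark.eval l =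
      ({q | ∃ c, 1 ≤ c ∧ c ≤ l.length ∧
          M.eval (l.mapIdx fun j a => (a, decide (j + 1 = c))) = q},
        M.eval (l.map fun a => (a, false))) := by
  induction l using List.reverseRecOn with
  | nil =>
    simp only [DFA.eval_nil, DFA.existsMark, List.length_nil, List.map_nil, Prod.mk.injEq, and_true]
    ext q
    simp only [Set.mem_empty_iff_false, Set.mem_ofPred_eq, false_iff]
    omega
  | append_singleton l a ih =>
    rw [DFA.eval_append_singleton, ih]
    simp only [DFA.existsMark, List.map_append, List.map_cons, List.map_nil,
      DFA.eval_append_singleton, List.mapIdx_concat, List.length_append, List.length_singleton,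
      Prod.mk.injEq, and_true]
    ext q
    simp only [Set.mem_ofPred_eq]
    constructor
    · rintro (⟨p, ⟨c, hc₁, hc₂, rfl⟩, rfl⟩ | rfl)
      · refine ⟨c, hc₁, by omega, ?_⟩
        rw [decide_eq_false (by omega)]
      · refine ⟨l.length + 1, by omega, le_rfl, ?_⟩
        rw [mapIdx_mark_of_length_lt l _ (by omega), decide_eq_true rfl]
    · rintro ⟨c, hc₁, hc₂, rfl⟩
      rcases Nat.lt_or_ge l.length c with h | h
      · right
        rw [mapIdx_mark_of_length_lt l _ h, decide_eq_true (by omega)]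
      · left
        refine ⟨_, ⟨c, hc₁, h, rfl⟩, ?_⟩
        rw [decide_eq_false (by omega)]

theorem IsRegularLang.existsMark {α : Type} {A : Set (List (α × Bool))} (hA : IsRegularLang A) :
    IsRegularLang (existsMark A) := by
  classical
  obtain ⟨Q, _, M, rfl⟩ := hA
  refine ⟨Set Q × Q, inferInstance, M.existsMark, ?_⟩
  ext l
  change M.existsMark.eval l ∈ {s : Set Q × Q | ∃ q ∈ s.1, q ∈ M.accept} ↔
    ∃ c, 1 ≤ c ∧ c ≤ l.length ∧ M.eval _ ∈ M.accept
  rw [DFA.eval_existsMark]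
  constructor
  · rintro ⟨q, ⟨c, hc₁, hc₂, rfl⟩, hq⟩
    exact ⟨c, hc₁, hc₂, hq⟩
  · rintro ⟨c, hc₁, hc₂, hq⟩
    exact ⟨_, ⟨c, hc₁, hc₂, rfl⟩, hq⟩

theorem IsRegularLang.preimage_map {α β : Type} {A : Set (List β)} (hA : IsRegularLang A)
    (f : α → β) : IsRegularLang {l : List α | l.map f ∈ A} := by
  obtain ⟨Q, hQ, M, rfl⟩ := hA
  exact ⟨Q, hQ, M.comap f, M.accepts_comap f⟩

theorem IsRegularLang.inter {α : Type} {A B : Set (List α)} (hA : IsRegularLang A)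
    (hB : IsRegularLang B) : IsRegularLang (A ∩ B) :=
  Language.IsRegular.inf (L1 := A) (L2 := B) hA hB

/-- Read the first resynchronizer, from the marked position to `y`. -/
def markToTarget {Sig : Type} (m n : ℕ) (a : RLetter Sig (m + n) × Bool) : RLetter Sig m :=
  (a.1.1, fun i => a.1.2.1 (Fin.castAdd n i), a.2, a.1.2.2.2)

/-- Read the second resynchronizer, from `x` to the marked position. -/
def sourceToMark {Sig : Type} (m n : ℕ) (a : RLetter Sig (m + n) × Bool) : RLetter Sig n :=
  (a.1.1, fun i => a.1.2.1 (Fin.natAdd m i), a.1.2.2.1, a.2)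

/-- The resynchronizer first applying `δ`, then `γ`, on disjoint sets of parameters. -/
def resyncComp {Sig : Type} {m n : ℕ} (γ : Set (List (RLetter Sig m)))
    (δ : Set (List (RLetter Sig n))) : Set (List (RLetter Sig (m + n))) :=
  existsMark ({l | l.map (markToTarget m n) ∈ γ} ∩ {l | l.map (sourceToMark m n) ∈ δ})

theorem IsRegularLang.resyncComp {Sig : Type} {m n : ℕ} {γ : Set (List (RLetter Sig m))}
    {δ : Set (List (RLetter Sig n))} (hγ : IsRegularLang γ) (hδ : IsRegularLang δ) :
    IsRegularLang (resyncComp γ δ) :=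
  ((hγ.preimage_map _).inter (hδ.preimage_map _)).existsMark

theorem map_mapIdx {α β δ : Type} (l : List α) (f : ℕ → α → β) (g : β → δ) :
    (l.mapIdx f).map g = l.mapIdx fun j a => g (f j a) := by
  apply List.ext_getElem <;> simp

theorem rSat_resyncComp {Sig : Type} {m n : ℕ} (γ : Set (List (RLetter Sig m)))
    (δ : Set (List (RLetter Sig n))) (u : List Sig) (I : Fin (m + n) → ℕ → Bool) (x y : ℕ) :
    RSat (resyncComp γ δ) u I x y ↔ ∃ w, 1 ≤ w ∧ w ≤ u.length ∧
      RSat γ u (fun i => I (Fin.castAdd n i)) w y ∧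
      RSat δ u (fun i => I (Fin.natAdd m i)) x w := by
  simp [RSat, resyncComp, existsMark, annot, List.mapIdx_mapIdx, map_mapIdx,
    Function.comp_def, markToTarget, sourceToMark]

theorem BoundedBy.resyncComp {Sig : Type} {m n k l : ℕ} {γ : Set (List (RLetter Sig m))}
    {δ : Set (List (RLetter Sig n))} (hγ : BoundedBy γ k) (hδ : BoundedBy δ l) :
    BoundedBy (resyncComp γ δ) (k * l) := by
  classical
  intro u I y hy₁ hy₂
  have card_eq : ∀ p : ℕ → Prop, {x : ℕ | 1 ≤ x ∧ x ≤ u.length ∧ p x}.ncard =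
      ((Finset.Icc 1 u.length).filter p).card := by
    intro p
    rw [← Set.ncard_coe_finset]
    congr 1
    ext x
    simp [and_assoc]
  let W := (Finset.Icc 1 u.length).filter fun w => RSat γ u (fun i => I (Fin.castAdd n i)) w y
  let X := fun w => (Finset.Icc 1 u.length).filter fun x =>
    RSat δ u (fun i => I (Fin.natAdd m i)) x w
  have hW : W.card ≤ k := by
    rw [← card_eq]
    exact hγ u _ y hy₁ hy₂
  have hX : ∀ w ∈ W, (X w).card ≤ l := by
    intro w hw
    obtain ⟨hw₁, hw₂⟩ := Finset.mem_Icc.mp (Finset.mem_filter.mp hw).1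
    rw [← card_eq]
    exact hδ u _ w hw₁ hw₂
  rw [card_eq]
  refine (Finset.card_le_card (t := W.biUnion X) ?_).trans
    ((Finset.card_biUnion_le_card_mul W X l hX).trans (Nat.mul_le_mul_right l hW))
  intro x hx
  obtain ⟨hx, hR⟩ := Finset.mem_filter.mp hx
  obtain ⟨w, hw₁, hw₂, hwy, hxw⟩ := (rSat_resyncComp γ δ u I x y).mp hR
  exact Finset.mem_biUnion.mpr ⟨w, Finset.mem_filter.mpr ⟨Finset.mem_Icc.mpr ⟨hw₁, hw₂⟩, hwy⟩,
    Finset.mem_filter.mpr ⟨hx, hxw⟩⟩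

theorem ResyncRel.comp {Sig Gam : Type} {m n : ℕ} {γ : Set (List (RLetter Sig m))}
    {δ : Set (List (RLetter Sig n))} {g₁ g₂ g₃ : OriginGraph Sig Gam}
    (h₂₁ : ResyncRel γ g₂ g₁) (h₃₂ : ResyncRel δ g₃ g₂) :
    ResyncRel (resyncComp γ δ) g₃ g₁ := by
  obtain ⟨hu₁, hv₁, I, hI⟩ := h₂₁
  obtain ⟨hu₂, hv₂, J, hJ⟩ := h₃₂
  refine ⟨hu₂.trans hu₁, hv₂.trans hv₁, Fin.append I J, fun z hz₁ hz₂ => ?_⟩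
  have hz₂' : z ≤ g₂.out.length := hv₁ ▸ hz₂
  obtain ⟨hw₁, hw₂⟩ := g₂.orig_mem z hz₁ hz₂'
  rw [rSat_resyncComp]
  refine ⟨g₂.orig z, hw₁, hu₂ ▸ hw₂, ?_, ?_⟩
  · simpa only [Fin.append_left, hu₂] using hI z hz₁ hz₂
  · simpa only [Fin.append_right] using hJ z hz₁ hz₂'

/-- The relation `⪯` is transitive. -/
theorem resyncLE_trans (Sig Gam : Type) [Fintype Sig] [Fintype Gam]
    (S₁ S₂ S₃ : Set (OriginGraph Sig Gam))
    (h12 : ResyncLE S₁ S₂) (h23 : ResyncLE S₂ S₃) : ResyncLE S₁ S₃ := by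
  obtain ⟨m, γ, hγ, ⟨k, hk⟩, h₁₂⟩ := h12
  obtain ⟨n, δ, hδ, ⟨l, hl⟩, h₂₃⟩ := h23
  refine ⟨m + n, resyncComp γ δ, hγ.resyncComp hδ, ⟨k * l, hk.resyncComp hl⟩, fun g₁ hg₁ => ?_⟩
  obtain ⟨g₂, hg₂, h₂₁⟩ := h₁₂ g₁ hg₁
  obtain ⟨g₃, hg₃, h₃₂⟩ := h₂₃ g₂ hg₂
  exact ⟨g₃, hg₃, h₂₁.comp h₃₂⟩
end

section
/- For every k ≥ 1, the resynchronizer R_k is a bounded regular resynchronizer: its language γ_k is a regular language over Σ × {0,1}^(2k+2), and R_k is bounded by 2k+1, i.e., for every nonempty word u ∈ Σ*, every choice of parameter sets Right₁,…,Right_k, Left₁,…,Left_k ⊆ {1,…,|u|}, and every position y ∈ {1,…,|u|}, there are at most 2k+1 distinct positions x with (u, Ī, x, y) ⊨ γ_k. -/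
/-- The defining condition of the resynchronizer `R_k`, with `2k` input parameters:
the first `k` parameters are `Right₁,…,Right_k` and the last `k` are `Left₁,…,Left_k`.
`(u, Ī, x, y) ⊨ γ_k` iff `x = y`, or `x ∈ Right_i`, `x < y` and no position `z` with
`x < z ≤ y` lies in `Right_i` (for some `i`), or `x ∈ Left_i`, `y < x` and no position
`z` with `y ≤ z < x` lies in `Left_i` (for some `i`). -/
def CondK {Sig : Type} (k : ℕ) (u : List Sig) (I : Fin (2 * k) → ℕ → Bool)
    (x y : ℕ) : Prop :=
  1 ≤ x ∧ x ≤ u.length ∧ 1 ≤ y ∧ y ≤ u.length ∧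
    (x = y ∨
      (∃ i : Fin (2 * k), (i : ℕ) < k ∧ I i x = true ∧ x < y ∧
        ∀ z, x < z → z ≤ y → I i z = false) ∨
      (∃ i : Fin (2 * k), k ≤ (i : ℕ) ∧ I i x = true ∧ y < x ∧
        ∀ z, y ≤ z → z < x → I i z = false))

/-- The language `γ_k` of the resynchronizer `R_k`. -/
def gammaK (Sig : Type) (k : ℕ) : Set (List (RLetter Sig (2 * k))) :=
  { w | ∃ u I x y, w = annot u I x y ∧ CondK k u I x y }

/-- The words all of whose letters satisfy `P`. -/
def allLetters {α : Type} (P : α → Prop) : Language α :=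
  {w | ∀ (j : ℕ) (c : α), w[j]? = some c → P c}

/-- The words consisting of letters satisfying `P`, then one letter satisfying `A`,
then a word of `L`. -/
def splitAt {α : Type} (P A : α → Prop) (L : Language α) : Language α :=
  {w | ∃ n a, w[n]? = some a ∧ A a ∧ (∀ j < n, ∀ c, w[j]? = some c → P c) ∧ w.drop (n + 1) ∈ L}

theorem nil_mem_allLetters {α : Type} (P : α → Prop) : [] ∈ allLetters P := by
  intro j c h
  simp at h

theorem cons_mem_allLetters {α : Type} (P : α → Prop) (a : α) (w : List α) :
    a :: w ∈ allLetters P ↔ P a ∧ w ∈ allLetters P := by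
  constructor
  · intro h
    exact ⟨h 0 a rfl, fun j c hc => h (j + 1) c hc⟩
  · rintro ⟨ha, h⟩ (_ | j) c hc
    · simp only [List.getElem?_cons_zero, Option.some.injEq] at hc
      exact hc ▸ ha
    · exact h j c hc

theorem isRegular_allLetters {α : Type} (P : α → Prop) : (allLetters P).IsRegular := by
  classical
  let M : DFA α Bool := ⟨fun s a => s && decide (P a), true, {true}⟩
  have hf : ∀ w, M.evalFrom false w = false := by
    intro w
    induction w with
    | nil => rfl
    | cons a w ih => simpa [DFA.evalFrom_cons, M] using ih
  have ht : ∀ w, M.evalFrom true w = true ↔ w ∈ allLetters P := by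
    intro w
    induction w with
    | nil => simpa using nil_mem_allLetters P
    | cons a w ih =>
      rw [cons_mem_allLetters, DFA.evalFrom_cons]
      by_cases ha : P a
      · simpa [M, ha] using ih
      · simpa [M, ha] using hf w
  exact ⟨Bool, inferInstance, M, Set.ext ht⟩

theorem nil_notMem_splitAt {α : Type} (P A : α → Prop) (L : Language α) :
    [] ∉ splitAt P A L := by
  rintro ⟨n, a, h, -⟩
  simp at h

theorem cons_mem_splitAt {α : Type} (P A : α → Prop) (L : Language α) (a : α) (w : List α) :
    a :: w ∈ splitAt P A L ↔ (A a ∧ w ∈ L) ∨ (P a ∧ w ∈ splitAt P A L) := by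
  constructor
  · rintro ⟨_ | n, b, hb, hA, hP, hL⟩
    · simp only [List.getElem?_cons_zero, Option.some.injEq] at hb
      exact Or.inl ⟨hb ▸ hA, hL⟩
    · exact Or.inr ⟨hP 0 (by omega) a rfl, n, b, hb, hA,
        fun j hj c hc => hP (j + 1) (by omega) c hc, hL⟩
  · rintro (⟨hA, hL⟩ | ⟨ha, n, b, hb, hA, hP, hL⟩)
    · exact ⟨0, a, rfl, hA, fun j hj => absurd hj (by omega), hL⟩
    · refine ⟨n + 1, b, hb, hA, ?_, hL⟩
      rintro (_ | j) hj c hc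
      · simp only [List.getElem?_cons_zero, Option.some.injEq] at hc
        exact hc ▸ ha
      · exact hP j (by omega) c hc

theorem isRegular_splitAt {α : Type} {P A : α → Prop} (hPA : ∀ a, P a → ¬ A a)
    {L : Language α} (hL : L.IsRegular) : (splitAt P A L).IsRegular := by
  classical
  obtain ⟨σ, _, M, rfl⟩ := hL
  let N : DFA α (Option (Option σ)) :=
    ⟨fun s a => match s with
      | none => if A a then some (some M.start) else if P a then none else some none
      | some none => some none
      | some (some q) => some (some (M.step q a)),
     none, {s | ∃ q ∈ M.accept, s = some (some q)}⟩
  have hdead : ∀ w, N.evalFrom (some none) w = some none := by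
    intro w
    induction w with
    | nil => rfl
    | cons a w ih => simpa [DFA.evalFrom_cons, N] using ih
  have hrun : ∀ w q, N.evalFrom (some (some q)) w = some (some (M.evalFrom q w)) := by
    intro w
    induction w with
    | nil => intro q; rfl
    | cons a w ih => intro q; simpa [DFA.evalFrom_cons, N] using ih (M.step q a)
  have hwait : ∀ w, N.evalFrom none w ∈ N.accept ↔ w ∈ splitAt P A M.accepts := by
    intro w
    induction w with
    | nil =>
      simp only [nil_notMem_splitAt, iff_false]
      simp [N]
    | cons a w ih =>
      rw [cons_mem_splitAt, DFA.evalFrom_cons]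
      by_cases hA : A a
      · have hP : ¬ P a := fun h => hPA a h hA
        have hs : N.step none a = some (some M.start) := by simp [N, hA]
        rw [hs, hrun]
        simp [N, hA, hP, DFA.mem_accepts, DFA.eval]
      · by_cases hP : P a
        · have hs : N.step none a = none := by simp [N, hA, hP]
          rw [hs, ih]
          simp [hA, hP]
        · have hs : N.step none a = some none := by simp [N, hA, hP]
          rw [hs, hdead]
          simp [N, hA, hP]
  exact ⟨_, inferInstance, N, Set.ext hwait⟩

theorem isRegular_iSup {α ι : Type} [Finite ι] {L : ι → Language α}
    (hL : ∀ i, (L i).IsRegular) : (⨆ i, L i).IsRegular := by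
  classical
  cases nonempty_fintype ι
  rw [← Finset.sup_univ_eq_iSup]
  refine Finset.sup_induction (p := Language.IsRegular) ?_ (fun _ h₁ _ h₂ => h₁.add h₂)
    fun i _ => hL i
  refine ⟨Unit, inferInstance, ⟨fun _ _ => (), (), ∅⟩, ?_⟩
  ext w
  exact Iff.rfl

theorem getElem?_annot {Sig : Type} {m : ℕ} (u : List Sig) (I : Fin m → ℕ → Bool)
    (x y j : ℕ) : (annot u I x y)[j]? =
      u[j]?.map fun a => (a, fun i => I i (j + 1), decide (j + 1 = x), decide (j + 1 = y)) := by
  simp [annot]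

theorem mem_gammaK_iff {Sig : Type} {k : ℕ} (w : List (RLetter Sig (2 * k))) :
    w ∈ gammaK Sig k ↔ ∃ x y, x < w.length ∧ y < w.length ∧
      (∀ j c, w[j]? = some c → c.2.2 = (decide (j = x), decide (j = y))) ∧
      (x = y ∨
        (∃ i : Fin (2 * k), (i : ℕ) < k ∧ x < y ∧ ∀ z c, w[z]? = some c →
          (z = x → c.2.1 i = true) ∧ (x < z → z ≤ y → c.2.1 i = false)) ∨
        (∃ i : Fin (2 * k), k ≤ (i : ℕ) ∧ y < x ∧ ∀ z c, w[z]? = some c →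
          (z = x → c.2.1 i = true) ∧ (y ≤ z → z < x → c.2.1 i = false))) := by
  constructor
  · rintro ⟨u, I, x, y, rfl, hx, hxu, hy, hyu, h⟩
    have hlen : (annot u I x y).length = u.length := by simp [annot]
    obtain ⟨x, rfl⟩ := Nat.exists_eq_add_of_le' hx
    obtain ⟨y, rfl⟩ := Nat.exists_eq_add_of_le' hy
    refine ⟨x, y, by omega, by omega, ?_, ?_⟩
    · intro j c hc
      rw [getElem?_annot, Option.map_eq_some_iff] at hc
      obtain ⟨a, -, rfl⟩ := hc
      simp
    · refine h.imp (by omega) (Or.imp ?_ ?_)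
      all_goals
        rintro ⟨i, hi, hI, hxy, hz⟩
        refine ⟨i, hi, by omega, fun z c hc => ?_⟩
        rw [getElem?_annot, Option.map_eq_some_iff] at hc
        obtain ⟨a, -, rfl⟩ := hc
        exact ⟨fun h => h ▸ hI, fun h₁ h₂ => hz _ (by omega) (by omega)⟩
  · rintro ⟨x, y, hx, hy, hm, h⟩
    let I : Fin (2 * k) → ℕ → Bool := fun i j => (w[j - 1]?.map fun c => c.2.1 i).getD false
    have hI : ∀ z c, w[z]? = some c → ∀ i, I i (z + 1) = c.2.1 i := by
      intro z c hc i
      simp [I, hc]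
    refine ⟨w.map Prod.fst, I, x + 1, y + 1, ?_, by omega, by simpa using hx, by omega,
      by simpa using hy, ?_⟩
    · apply List.ext_getElem?
      intro j
      rw [getElem?_annot, List.getElem?_map]
      cases hc : w[j]? with
      | none => rfl
      | some c =>
        have := hm j c hc
        simp only [Option.map_some, hI j c hc, add_left_inj]
        rw [Prod.ext_iff] at this
        exact congrArg some (Prod.ext rfl (Prod.ext rfl (Prod.ext this.1 this.2)))
    · refine h.imp (by omega) (Or.imp ?_ ?_)
      all_goals
        rintro ⟨i, hi, hxy, hz⟩
        refine ⟨i, hi, ?_, by omega, ?_⟩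
        · have hc := List.getElem?_eq_getElem hx
          rw [hI _ _ hc]
          exact (hz _ _ hc).1 rfl
        · intro z h₁ h₂
          obtain ⟨z, rfl⟩ := Nat.exists_eq_add_of_le' (show 1 ≤ z by omega)
          have hc := List.getElem?_eq_getElem (l := w) (i := z) (by omega)
          rw [hI _ _ hc]
          exact (hz _ _ hc).2 (by omega) (by omega)

/-- The words in which the marked positions `x` and `y` coincide. -/
def diagLang (Sig : Type) (m : ℕ) : Language (RLetter Sig m) :=
  splitAt (fun c => c.2.2 = (false, false)) (fun c => c.2.2 = (true, true))
    (allLetters fun c => c.2.2 = (false, false))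

/-- The words with `x < y` where `x` is the last position up to `y` in parameter `i`. -/
def rightLang (Sig : Type) {m : ℕ} (i : Fin m) : Language (RLetter Sig m) :=
  splitAt (fun c => c.2.2 = (false, false)) (fun c => c.2.2 = (true, false) ∧ c.2.1 i = true)
    (splitAt (fun c => c.2.2 = (false, false) ∧ c.2.1 i = false)
      (fun c => c.2.2 = (false, true) ∧ c.2.1 i = false)
      (allLetters fun c => c.2.2 = (false, false)))

/-- The words with `y < x` where `x` is the first position from `y` on in parameter `i`. -/
def leftLang (Sig : Type) {m : ℕ} (i : Fin m) : Language (RLetter Sig m) :=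
  splitAt (fun c => c.2.2 = (false, false)) (fun c => c.2.2 = (false, true) ∧ c.2.1 i = false)
    (splitAt (fun c => c.2.2 = (false, false) ∧ c.2.1 i = false)
      (fun c => c.2.2 = (true, false) ∧ c.2.1 i = true)
      (allLetters fun c => c.2.2 = (false, false)))

theorem mem_splitAt_allLetters {α : Type} {P A R : α → Prop} (w : List α) :
    w ∈ splitAt P A (allLetters R) ↔ ∃ x < w.length, ∀ j c, w[j]? = some c →
      (j < x → P c) ∧ (j = x → A c) ∧ (x < j → R c) := by
  constructor
  · rintro ⟨n, a, ha, hA, hP, hR⟩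
    refine ⟨n, (List.getElem?_eq_some_iff.1 ha).1, fun j c hc => ⟨fun h => hP j h c hc, ?_, ?_⟩⟩
    · rintro rfl
      rw [ha] at hc
      exact Option.some.inj hc ▸ hA
    · intro h
      refine hR (j - (n + 1)) c ?_
      rw [List.getElem?_drop, ← hc]
      congr 1
      omega
  · rintro ⟨x, hx, h⟩
    have hc := List.getElem?_eq_getElem hx
    refine ⟨x, w[x], hc, (h _ _ hc).2.1 rfl, fun j hj c hc => (h j c hc).1 hj, fun j c hc => ?_⟩
    rw [List.getElem?_drop] at hc
    exact (h _ c hc).2.2 (by omega)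

theorem mem_splitAt_splitAt_allLetters {α : Type} {P A Q B R : α → Prop} (w : List α) :
    w ∈ splitAt P A (splitAt Q B (allLetters R)) ↔
      ∃ x y, x < y ∧ y < w.length ∧ ∀ j c, w[j]? = some c →
        (j < x → P c) ∧ (j = x → A c) ∧ (x < j → j < y → Q c) ∧ (j = y → B c) ∧
          (y < j → R c) := by
  constructor
  · rintro ⟨n, a, ha, hA, hP, hL⟩
    obtain ⟨m, hm, h⟩ := (mem_splitAt_allLetters _).1 hL
    rw [List.length_drop] at hm
    refine ⟨n, n + 1 + m, by omega, by omega, fun j c hc => ⟨fun h => hP j h c hc, ?_, ?_⟩⟩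
    · rintro rfl
      rw [ha] at hc
      exact Option.some.inj hc ▸ hA
    · by_cases hj : n < j
      · obtain ⟨d, rfl⟩ := Nat.exists_eq_add_of_le (show n + 1 ≤ j by omega)
        obtain ⟨h₁, h₂, h₃⟩ := h d c (by rw [List.getElem?_drop, hc])
        exact ⟨fun _ _ => h₁ (by omega), fun _ => h₂ (by omega), fun _ => h₃ (by omega)⟩
      · exact ⟨by omega, by omega, by omega⟩
  · rintro ⟨x, y, hxy, hy, h⟩
    have hc := List.getElem?_eq_getElem (hxy.trans hy)
    refine ⟨x, w[x], hc, (h _ _ hc).2.1 rfl, fun j hj c hc => (h j c hc).1 hj,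
      (mem_splitAt_allLetters _).2 ⟨y - (x + 1), ?_, fun j c hc => ?_⟩⟩
    · rw [List.length_drop]
      omega
    · rw [List.getElem?_drop] at hc
      obtain ⟨-, -, h₁, h₂, h₃⟩ := h _ c hc
      exact ⟨fun _ => h₁ (by omega) (by omega), fun _ => h₂ (by omega), fun _ => h₃ (by omega)⟩

theorem mem_diagLang {Sig : Type} {m : ℕ} (w : List (RLetter Sig m)) :
    w ∈ diagLang Sig m ↔ ∃ x < w.length,
      ∀ j c, w[j]? = some c → c.2.2 = (decide (j = x), decide (j = x)) := by
  rw [diagLang, mem_splitAt_allLetters]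
  refine exists_congr fun x => and_congr_right fun _ => forall₃_congr fun j c _ => ?_
  rcases lt_trichotomy j x with h | h | h
  · simp [h, h.ne, h.not_gt]
  · simp [h]
  · simp [h, h.ne', h.not_gt]

theorem mem_rightLang {Sig : Type} {m : ℕ} (i : Fin m) (w : List (RLetter Sig m)) :
    w ∈ rightLang Sig i ↔ ∃ x y, x < y ∧ y < w.length ∧ ∀ j c, w[j]? = some c →
      c.2.2 = (decide (j = x), decide (j = y)) ∧
      (j = x → c.2.1 i = true) ∧ (x < j → j ≤ y → c.2.1 i = false) := by
  rw [rightLang, mem_splitAt_splitAt_allLetters]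
  refine exists₂_congr fun x y => and_congr_right fun hxy => and_congr_right fun _ =>
    forall₃_congr fun j c _ => ?_
  obtain ⟨a, f, p, q⟩ := c
  simp only [Prod.mk.injEq]
  grind

theorem mem_leftLang {Sig : Type} {m : ℕ} (i : Fin m) (w : List (RLetter Sig m)) :
    w ∈ leftLang Sig i ↔ ∃ y x, y < x ∧ x < w.length ∧ ∀ j c, w[j]? = some c →
      c.2.2 = (decide (j = x), decide (j = y)) ∧
      (j = x → c.2.1 i = true) ∧ (y ≤ j → j < x → c.2.1 i = false) := by
  rw [leftLang, mem_splitAt_splitAt_allLetters]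
  refine exists₂_congr fun y x => and_congr_right fun hxy => and_congr_right fun _ =>
    forall₃_congr fun j c _ => ?_
  obtain ⟨a, f, p, q⟩ := c
  simp only [Prod.mk.injEq]
  grind

theorem isRegular_diagLang (Sig : Type) (m : ℕ) : (diagLang Sig m).IsRegular :=
  isRegular_splitAt (by simp +contextual) (isRegular_allLetters _)

theorem isRegular_rightLang (Sig : Type) {m : ℕ} (i : Fin m) : (rightLang Sig i).IsRegular :=
  isRegular_splitAt (by simp +contextual)
    (isRegular_splitAt (by simp +contextual) (isRegular_allLetters _))

theorem isRegular_leftLang (Sig : Type) {m : ℕ} (i : Fin m) : (leftLang Sig i).IsRegular :=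
  isRegular_splitAt (by simp +contextual)
    (isRegular_splitAt (by simp +contextual) (isRegular_allLetters _))

theorem gammaK_eq (Sig : Type) (k : ℕ) :
    gammaK Sig k = diagLang Sig (2 * k) +
      ⨆ i : Fin (2 * k), if (i : ℕ) < k then rightLang Sig i else leftLang Sig i := by
  refine Set.ext fun w => ?_
  change w ∈ gammaK Sig k ↔ w ∈ diagLang Sig (2 * k) + _
  rw [Language.mem_add, Language.mem_iSup, mem_gammaK_iff, mem_diagLang]
  constructor
  · rintro ⟨x, y, hx, hy, hm, rfl | ⟨i, hi, hxy, h⟩ | ⟨i, hi, hxy, h⟩⟩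
    · exact Or.inl ⟨x, hx, hm⟩
    · refine Or.inr ⟨i, ?_⟩
      rw [if_pos hi, mem_rightLang]
      exact ⟨x, y, hxy, hy, fun j c hc => ⟨hm j c hc, h j c hc⟩⟩
    · refine Or.inr ⟨i, ?_⟩
      rw [if_neg hi.not_gt, mem_leftLang]
      exact ⟨y, x, hxy, hx, fun j c hc => ⟨hm j c hc, h j c hc⟩⟩
  · rintro (⟨x, hx, hm⟩ | ⟨i, h⟩)
    · exact ⟨x, x, hx, hx, hm, Or.inl rfl⟩
    · split_ifs at h with hi
      · obtain ⟨x, y, hxy, hy, h⟩ := (mem_rightLang i w).1 h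
        exact ⟨x, y, hxy.trans hy, hy, fun j c hc => (h j c hc).1,
          Or.inr (Or.inl ⟨i, hi, hxy, fun j c hc => (h j c hc).2⟩)⟩
      · obtain ⟨y, x, hxy, hx, h⟩ := (mem_leftLang i w).1 h
        exact ⟨x, y, hx, hxy.trans hx, fun j c hc => (h j c hc).1,
          Or.inr (Or.inr ⟨i, not_lt.1 hi, hxy, fun j c hc => (h j c hc).2⟩)⟩

theorem isRegularLang_gammaK (Sig : Type) (k : ℕ) : IsRegularLang (gammaK Sig k) := by
  rw [gammaK_eq]
  refine (isRegular_diagLang Sig (2 * k)).add (isRegular_iSup fun i => ?_)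
  split_ifs
  · exact isRegular_rightLang Sig i
  · exact isRegular_leftLang Sig i

theorem condK_of_rSat {Sig : Type} {k : ℕ} {u : List Sig} {I : Fin (2 * k) → ℕ → Bool}
    {x y : ℕ} (h : RSat (gammaK Sig k) u I x y) : CondK k u I x y := by
  obtain ⟨u', I', x', y', h, hx, hxu, hy, hyu, hc⟩ := h
  have hlen : u.length = u'.length := by simpa [annot] using congrArg List.length h
  have key : ∀ j, 1 ≤ j → j ≤ u'.length →
      (∀ i, I i j = I' i j) ∧ (j = x ↔ j = x') ∧ (j = y ↔ j = y') := by
    intro j h₁ h₂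
    obtain ⟨j, rfl⟩ := Nat.exists_eq_add_of_le' h₁
    have hj := congrArg (fun l => l[j]?) h
    simp only [getElem?_annot, List.getElem?_eq_getElem (show j < u.length by omega),
      List.getElem?_eq_getElem (show j < u'.length by omega), Option.map_some,
      Option.some.injEq, Prod.mk.injEq, decide_eq_decide] at hj
    exact ⟨congrFun hj.2.1, hj.2.2⟩
  obtain rfl := (key x' hx hxu).2.1.2 rfl
  obtain rfl := (key y' hy hyu).2.2.2 rfl
  refine ⟨hx, by omega, hy, by omega, hc.imp_right (Or.imp ?_ ?_)⟩
  all_goals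
    rintro ⟨i, hi, hI, hxy, hz⟩
    refine ⟨i, hi, by rwa [(key _ hx hxu).1], hxy, fun z h₁ h₂ => ?_⟩
    rw [(key z (by omega) (by omega)).1]
    exact hz z h₁ h₂

theorem boundedBy_gammaK (Sig : Type) (k : ℕ) : BoundedBy (gammaK Sig k) (2 * k + 1) := by
  classical
  intro u I y _ _
  let W : Option (Fin (2 * k)) → ℕ → Prop := fun o x => match o with
    | none => x = y
    | some i => I i x = true ∧
        (((i : ℕ) < k ∧ x < y ∧ ∀ z, x < z → z ≤ y → I i z = false) ∨
          (k ≤ (i : ℕ) ∧ y < x ∧ ∀ z, y ≤ z → z < x → I i z = false))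
  have hW : ∀ x, RSat (gammaK Sig k) u I x y → ∃ o, W o x := by
    intro x h
    obtain ⟨-, -, -, -, h | ⟨i, hi, hI, hxy, hz⟩ | ⟨i, hi, hI, hxy, hz⟩⟩ := condK_of_rSat h
    · exact ⟨none, h⟩
    · exact ⟨some i, hI, Or.inl ⟨hi, hxy, hz⟩⟩
    · exact ⟨some i, hI, Or.inr ⟨hi, hxy, hz⟩⟩
  have huniq : ∀ o x x', W o x → W o x' → x = x' := by
    rintro (_ | i) x x' h h'
    · exact Eq.trans h (Eq.symm h')
    · simp only [W] at h h'
      grind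
  choose! f hf using hW
  have hcard := Set.ncard_le_ncard_of_injOn
    (s := {x : ℕ | 1 ≤ x ∧ x ≤ u.length ∧ RSat (gammaK Sig k) u I x y})
    (t := Set.univ) f (fun _ _ => Set.mem_univ _)
    (fun x hx x' hx' h => huniq (f x) x x' (hf x hx.2.2) (h ▸ hf x' hx'.2.2))
  simpa [Set.ncard_univ] using hcard

/-- For every `k ≥ 1`, the resynchronizer `R_k` is a bounded regular resynchronizer:
its language `γ_k` is regular and `R_k` is bounded by `2k + 1`. -/
theorem gammaK_regular_and_bounded (Sig : Type) [Fintype Sig] (k : ℕ) (hk : 1 ≤ k) :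
    IsRegularLang (gammaK Sig k) ∧ BoundedBy (gammaK Sig k) (2 * k + 1) :=
  ⟨isRegularLang_gammaK Sig k, boundedBy_gammaK Sig k⟩
end

section
/- Assume the output alphabet Γ is nonempty. If a regular resynchronizer R (with m input parameters) has limited traversal, then R is bounded. Equivalently, as proved by contraposition: if R is not bounded, then for every k ∈ ℕ there exists a pair of origin graphs (σ, σ') ∈ ⟦R⟧ that does not have k-traversal. -/
/-- The set of input positions traversing `z` is finite. -/
theorem finite_setOf_traverses {Sig Gam : Type} (g g' : OriginGraph Sig Gam) (z : ℕ) :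
    {x : ℕ | Traverses g g' x z}.Finite := by
  refine ((Set.finite_Icc 1 g.out.length).image g.orig).subset ?_
  rintro x ⟨t, h1, h2, h3, -⟩
  exact ⟨t, ⟨h1, h2⟩, h3⟩

/-- If some source position can be redirected to `y`, there is a pair in the semantics of the
resynchronizer that redirects all such source positions to `y` simultaneously. -/
theorem exists_resyncRel_redirect {Sig Gam : Type} [Nonempty Gam] {m : ℕ}
    (γ : Set (List (RLetter Sig m))) (u : List Sig) (I : Fin m → ℕ → Bool) (x₀ y : ℕ)
    (hy1 : 1 ≤ y) (hy2 : y ≤ u.length) (hx1 : 1 ≤ x₀) (hx2 : x₀ ≤ u.length)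
    (hx₀ : RSat γ u I x₀ y) :
    ∃ g g' : OriginGraph Sig Gam, ResyncRel γ g g' ∧ g.inp = u ∧
      ∀ x, 1 ≤ x → x ≤ u.length → RSat γ u I x y →
        ∃ t, 1 ≤ t ∧ t ≤ g.out.length ∧ g.orig t = x ∧ g'.orig t = y := by
  classical
  have hne : u ≠ [] := by
    rintro rfl
    simp at hy2
    omega
  let v : List Gam := List.replicate u.length (Classical.arbitrary Gam)
  refine ⟨⟨u, v, fun t => if RSat γ u I t y then t else x₀, hne, ?_⟩,
    ⟨u, v, fun _ => y, hne, fun _ _ _ => ⟨hy1, hy2⟩⟩, ⟨rfl, rfl, I, ?_⟩, rfl, ?_⟩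
  · intro t h1 h2
    simp only [v, List.length_replicate] at h2
    split_ifs <;> omega
  · intro t _ _
    dsimp only
    split_ifs with h
    · exact h
    · exact hx₀
  · intro x h1 h2 h
    exact ⟨x, h1, by simpa [v] using h2, by simp [h], rfl⟩

/-- If a regular resynchronizer has limited traversal (some `k`-traversal bound on all
pairs of origin graphs in its semantics), then it is bounded. -/
theorem limitedTraversal_implies_bounded (Sig Gam : Type) [Fintype Sig] [Fintype Gam]
    [Nonempty Gam] (m : ℕ) (γ : Set (List (RLetter Sig m)))
    (hreg : IsRegularLang γ)
    (hlim : ∃ k : ℕ, ∀ g g' : OriginGraph Sig Gam, ResyncRel γ g g' → HasTraversal k g g') :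
    BoundedResync γ := by
  obtain ⟨k, hk⟩ := hlim
  refine ⟨k + k + 1, fun u I y hy1 hy2 => ?_⟩
  set S := {x : ℕ | 1 ≤ x ∧ x ≤ u.length ∧ RSat γ u I x y} with hS
  obtain hempty | ⟨x₀, hx1, hx2, hx₀⟩ := S.eq_empty_or_nonempty
  · simp [hempty]
  obtain ⟨g, g', hR, rfl, hg⟩ :=
    exists_resyncRel_redirect (Gam := Gam) γ u I x₀ y hy1 hy2 hx1 hx2 hx₀
  have hfin : S.Finite := (Set.finite_Icc 1 g.inp.length).subset fun x hx => ⟨hx.1, hx.2.1⟩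
  have hleft : (S ∩ Set.Iio y).ncard ≤ k := by
    by_cases hy : y = 1
    · have : S ∩ Set.Iio y = ∅ := by
        ext x
        simp only [hS, Set.mem_inter_iff, Set.mem_ofPred_eq, Set.mem_Iio, Set.mem_empty_iff_false,
          iff_false]
        omega
      simp [this]
    · refine (Set.ncard_le_ncard ?_ (finite_setOf_traverses g g' (y - 1))).trans
        (hk g g' hR (y - 1) (by omega) (by omega))
      rintro x ⟨⟨h1, h2, h3⟩, hlt : x < y⟩
      obtain ⟨t, ht1, ht2, hx, hyt⟩ := hg x h1 h2 h3
      exact ⟨t, ht1, ht2, hx, Or.inl (by omega)⟩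
  have hright : (S ∩ Set.Ioi y).ncard ≤ k := by
    by_cases hy : y = g.inp.length
    · have : S ∩ Set.Ioi y = ∅ := by
        ext x
        simp only [hS, Set.mem_inter_iff, Set.mem_ofPred_eq, Set.mem_Ioi, Set.mem_empty_iff_false,
          iff_false]
        omega
      simp [this]
    · refine (Set.ncard_le_ncard ?_ (finite_setOf_traverses g g' (y + 1))).trans
        (hk g g' hR (y + 1) (by omega) (by omega))
      rintro x ⟨⟨h1, h2, h3⟩, hlt : y < x⟩
      obtain ⟨t, ht1, ht2, hx, hyt⟩ := hg x h1 h2 h3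
      exact ⟨t, ht1, ht2, hx, Or.inr (by omega)⟩
  have hcover : S ⊆ (S ∩ Set.Iio y ∪ S ∩ Set.Ioi y) ∪ {y} := by
    intro x hx
    rcases lt_trichotomy x y with h | h | h
    · exact Or.inl (Or.inl ⟨hx, h⟩)
    · exact Or.inr h
    · exact Or.inl (Or.inr ⟨hx, h⟩)
  calc S.ncard ≤ ((S ∩ Set.Iio y ∪ S ∩ Set.Ioi y) ∪ {y}).ncard :=
        Set.ncard_le_ncard hcover (((hfin.inter_of_left _).union (hfin.inter_of_left _)).union
          (Set.finite_singleton y))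
    _ ≤ (S ∩ Set.Iio y ∪ S ∩ Set.Ioi y).ncard + ({y} : Set ℕ).ncard := Set.ncard_union_le _ _
    _ ≤ k + k + 1 := by
        have := Set.ncard_union_le (S ∩ Set.Iio y) (S ∩ Set.Ioi y)
        rw [Set.ncard_singleton]
        omega
end

section
/- If the language γ of a regular resynchronizer R with m input parameters is recognized by a DFA with s states, and R is bounded by b, then R has limited traversal; more precisely, every pair of origin graphs in ⟦R⟧ has 2·(b+1)·s-traversal. -/
theorem annot_take_eq {Sig : Type} {m : ℕ} (u : List Sig) (I : Fin m → ℕ → Bool)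
    {c x y x' y' : ℕ} (h : ∀ j ≤ c, 1 ≤ j → ((j = x ↔ j = x') ∧ (j = y ↔ j = y'))) :
    (annot u I x y).take c = (annot u I x' y').take c := by
  refine List.ext_getElem (by simp [annot]) fun i h₁ _ => ?_
  have hi : i + 1 ≤ c := by
    rw [List.length_take] at h₁
    omega
  simp [annot, h (i + 1) hi (by omega)]

theorem annot_drop_eq {Sig : Type} {m : ℕ} (u : List Sig) (I : Fin m → ℕ → Bool)
    {c x y x' y' : ℕ} (h : ∀ j > c, ((j = x ↔ j = x') ∧ (j = y ↔ j = y'))) :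
    (annot u I x y).drop c = (annot u I x' y').drop c := by
  refine List.ext_getElem (by simp [annot]) fun i _ _ => ?_
  simp [annot, h (c + i + 1) (by omega)]

theorem DFA.mem_accepts_take_append_drop {α Q : Type} (M : DFA α Q) {c : ℕ} {v w : List α}
    (h : M.eval (v.take c) = M.eval (w.take c)) (hw : w ∈ M.accepts) :
    v.take c ++ w.drop c ∈ M.accepts := by
  rw [← List.take_append_drop c w] at hw
  simp only [DFA.mem_accepts, DFA.eval, DFA.evalFrom_of_append] at h hw ⊢
  rwa [h]

/-- If any two sources in the same class under `f` may share a target, then boundedness limits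
the size of each class. -/
theorem BoundedBy.ncard_le {Sig : Type} {m : ℕ} {γ : Set (List (RLetter Sig m))} {b : ℕ}
    (hb : BoundedBy γ b) {Q : Type} [Fintype Q] {u : List Sig} {I : Fin m → ℕ → Bool}
    {S : Set ℕ} (hS : ∀ x ∈ S, 1 ≤ x ∧ x ≤ u.length) (Y : ℕ → ℕ)
    (hY : ∀ x ∈ S, 1 ≤ Y x ∧ Y x ≤ u.length) (f : ℕ → Q)
    (hf : ∀ x ∈ S, ∀ x' ∈ S, f x = f x' → RSat γ u I x' (Y x)) :
    S.ncard ≤ b * Fintype.card Q := by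
  classical
  have hfin : S.Finite := (Set.finite_Icc 1 u.length).subset hS
  rw [Set.ncard_eq_toFinset_card S hfin]
  refine (Finset.card_le_mul_card_image (f := f) _ b fun q hq => ?_).trans
    (Nat.mul_le_mul_left b (Finset.card_le_univ _))
  obtain ⟨x, hx, rfl⟩ := Finset.mem_image.1 hq
  rw [Set.Finite.mem_toFinset] at hx
  refine le_trans ?_ (hb u I (Y x) (hY x hx).1 (hY x hx).2)
  rw [← Set.ncard_coe_finset]
  refine Set.ncard_le_ncard (fun x' hx' => ?_)
    ((Set.finite_Icc 1 u.length).subset fun x h => ⟨h.1, h.2.1⟩)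
  obtain ⟨hx', hq'⟩ : x' ∈ S ∧ f x' = f x := by simpa using hx'
  exact ⟨(hS x' hx').1, (hS x' hx').2, hf x hx x' hx' hq'.symm⟩

theorem BoundedBy.ncard_rightward_le {Sig : Type} {m : ℕ} {Q : Type} [Fintype Q]
    {M : DFA (RLetter Sig m) Q} {b : ℕ} (hb : BoundedBy M.accepts b) (u : List Sig)
    (I : Fin m → ℕ → Bool) (c : ℕ) :
    {x | 1 ≤ x ∧ x ≤ c ∧ ∃ y, c < y ∧ y ≤ u.length ∧ RSat M.accepts u I x y}.ncard
      ≤ b * Fintype.card Q := by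
  have hex : ∀ x ∈ {x | 1 ≤ x ∧ x ≤ c ∧ ∃ y, c < y ∧ y ≤ u.length ∧ RSat M.accepts u I x y}, _ :=
    fun _ hx => hx.2.2
  choose! Y hY using hex
  refine hb.ncard_le (u := u) (I := I) (fun x hx => ?_) Y (fun x hx => ?_)
    (fun x => M.eval ((annot u I x (Y x)).take c)) fun x hx x' hx' hf => ?_
  · have := hY x hx
    obtain ⟨h₁, h₂, _⟩ := hx
    omega
  · have := hY x hx
    obtain ⟨h₁, h₂, _⟩ := hx
    omega
  · obtain ⟨h₂, _, hw⟩ := hY x hx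
    obtain ⟨h₂', _, _⟩ := hY x' hx'
    have h₁ := hx.2.1
    have h₁' := hx'.2.1
    have := M.mem_accepts_take_append_drop hf.symm hw
    rwa [annot_take_eq u I (x' := x') (y' := Y x) (by omega),
      annot_drop_eq u I (x' := x') (y' := Y x) (by omega), List.take_append_drop] at this

theorem BoundedBy.ncard_leftward_le {Sig : Type} {m : ℕ} {Q : Type} [Fintype Q]
    {M : DFA (RLetter Sig m) Q} {b : ℕ} (hb : BoundedBy M.accepts b) (u : List Sig)
    (I : Fin m → ℕ → Bool) (c : ℕ) :
    {x | c < x ∧ x ≤ u.length ∧ ∃ y, 1 ≤ y ∧ y ≤ c ∧ RSat M.accepts u I x y}.ncard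
      ≤ b * Fintype.card Q := by
  have hex : ∀ x ∈ {x | c < x ∧ x ≤ u.length ∧ ∃ y, 1 ≤ y ∧ y ≤ c ∧ RSat M.accepts u I x y}, _ :=
    fun _ hx => hx.2.2
  choose! Y hY using hex
  refine hb.ncard_le (u := u) (I := I) (fun x hx => ?_) Y (fun x hx => ?_)
    (fun x => M.eval ((annot u I x (Y x)).take c)) fun x hx x' hx' hf => ?_
  · have := hY x hx
    obtain ⟨h₁, h₂, _⟩ := hx
    omega
  · have := hY x hx
    obtain ⟨h₁, h₂, _⟩ := hx
    omega
  · obtain ⟨_, h₂, _⟩ := hY x hx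
    obtain ⟨_, h₂', hw⟩ := hY x' hx'
    have h₁ := hx.1
    have h₁' := hx'.1
    have := M.mem_accepts_take_append_drop hf hw
    rwa [annot_take_eq u I (x' := x') (y' := Y x) (by omega),
      annot_drop_eq u I (x' := x') (y' := Y x) (by omega), List.take_append_drop] at this

/-- If the language `γ` of a regular resynchronizer with `m` input parameters is
recognized by a DFA with `s` states and the resynchronizer is bounded by `b`, then it has
limited traversal: every pair of origin graphs in its semantics has `2·(b+1)·s`-traversal. -/
theorem bounded_implies_limitedTraversal (Sig Gam : Type) [Fintype Sig] [Fintype Gam]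
    (m : ℕ) (γ : Set (List (RLetter Sig m)))
    (Q : Type) [Fintype Q] (M : DFA (RLetter Sig m) Q) (hM : M.accepts = γ)
    (s : ℕ) (hs : Fintype.card Q = s) (b : ℕ) (hb : BoundedBy γ b) :
    ∀ g g' : OriginGraph Sig Gam, ResyncRel γ g g' →
      HasTraversal (2 * (b + 1) * s) g g' := by
  subst hM hs
  rintro g g' ⟨hinp, hout, I, hI⟩ z hz _
  have hfin : ({x | 1 ≤ x ∧ x ≤ z ∧ ∃ y, z < y ∧ y ≤ g.inp.length ∧
      RSat M.accepts g.inp I x y} ∪ {x | z - 1 < x ∧ x ≤ g.inp.length ∧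
      ∃ y, 1 ≤ y ∧ y ≤ z - 1 ∧ RSat M.accepts g.inp I x y}).Finite :=
    ((Set.finite_Iic z).subset fun x hx => hx.2.1).union
      ((Set.finite_Iic g.inp.length).subset fun x hx => hx.2.1)
  refine (Set.ncard_le_ncard (fun x hx => ?_) hfin).trans <| (Set.ncard_union_le _ _).trans <|
    (Nat.add_le_add (hb.ncard_rightward_le g.inp I z)
      (hb.ncard_leftward_le g.inp I (z - 1))).trans ?_
  · obtain ⟨t, ht₁, ht₂, rfl, ht⟩ := hx
    obtain ⟨h₁, h₂⟩ := g.orig_mem t ht₁ ht₂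
    obtain ⟨h₁', h₂'⟩ := g'.orig_mem t ht₁ (hout ▸ ht₂)
    rw [← hinp] at h₂'
    have hsat := hI t ht₁ (hout ▸ ht₂)
    rcases ht with ht | ht
    · exact Or.inl ⟨h₁, ht.1, g'.orig t, ht.2, h₂', hsat⟩
    · exact Or.inr ⟨by omega, h₂, g'.orig t, h₁', by omega, hsat⟩
  · nlinarith
end

section
/- The resynchronizers R_k are universal: for all sets S₁, S₂ of origin graphs over finite alphabets Σ and Γ, if S₁ ⪯ S₂ (some bounded regular resynchronizer R satisfies S₁ ⊆ R(S₂)), then there exists k ≥ 1 such that S₁ ⊆ R_k(S₂). -/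
/-- If each vertex has at most `K` predecessors along a well-founded relation, greedy colouring
uses at most `K + 1` colours. -/
theorem exists_greedy_coloring {α : Type*} {r : α → α → Prop} (hr : WellFounded r) {K : ℕ}
    (hfin : ∀ a, {b | r b a}.Finite) (hK : ∀ a, {b | r b a}.ncard ≤ K) :
    ∃ c : α → Fin (K + 1), ∀ a b, r b a → c b ≠ c a := by
  classical
  have hfree (a : α) (f : ∀ b, r b a → Fin (K + 1)) : ∃ i, ∀ b h, f b h ≠ i := by
    by_contra! hcon
    choose g hg hfg using hcon
    have hginj : Function.Injective g := by
      intro i j hij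
      have hf (b b') (hb : r b a) (hb' : r b' a) (h : b = b') : f b hb = f b' hb' := by
        subst h
        rfl
      rw [← hfg i, ← hfg j]
      exact hf _ _ _ _ hij
    have hle : (Set.range g).ncard ≤ K :=
      (Set.ncard_le_ncard (Set.range_subset_iff.2 hg) (hfin a)).trans (hK a)
    rw [← Set.image_univ, Set.ncard_image_of_injective _ hginj, Set.ncard_univ,
      Nat.card_eq_fintype_card, Fintype.card_fin] at hle
    omega
  choose pick hpick using hfree
  refine ⟨hr.fix pick, fun a b hba => ?_⟩
  rw [hr.fix_eq pick a]
  exact hpick a (fun b _ => hr.fix pick b) b hba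

/-- If `P` has fibres of size at most `k` and the finite label `l` decides whether sources can be
exchanged, then `P` has at most `k * card Q` sources. -/
theorem ncard_sources_le {α β Q : Type*} [Fintype Q] {k : ℕ} {P : α → β → Prop} (l : α → β → Q)
    (hfin : {x | ∃ y, P x y}.Finite) (hk : ∀ y, {x | P x y}.ncard ≤ k)
    (hl : ∀ x y x' y', P x y → P x' y' → l x y = l x' y' → P x' y) :
    {x | ∃ y, P x y}.ncard ≤ k * Fintype.card Q := by
  classical
  rcases isEmpty_or_nonempty β with hβ | hβ
  · simp
  choose! t ht using fun (x : α) (h : ∃ y, P x y) => h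
  rw [Set.ncard_eq_toFinset_card _ hfin]
  refine (Finset.card_le_mul_card_image (f := fun x => l x (t x)) _ k ?_).trans
    (Nat.mul_le_mul_left k (Finset.card_le_univ _))
  intro q hq
  obtain ⟨x, hx, rfl⟩ := Finset.mem_image.1 hq
  have hx' : P x (t x) := ht x (by simpa using hx)
  refine le_trans ?_ (hk (t x))
  rw [← Set.ncard_coe_finset]
  refine Set.ncard_le_ncard ?_ (hfin.subset fun a ha => ⟨_, ha⟩)
  intro a ha
  simp only [Finset.coe_filter, Set.Finite.mem_toFinset, Set.mem_ofPred_eq] at ha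
  exact hl x (t x) a (t a) hx' (ht a ha.1) ha.2.symm

/-- Swapping sources of two pairs that cross the same input position in the same direction and
reach the same automaton state there. -/
theorem rSat_exchange {Sig Q : Type} {m : ℕ} (M : DFA (RLetter Sig m) Q) (u : List Sig)
    (I : Fin m → ℕ → Bool) {z x y x' y' : ℕ}
    (hcross : (x ≤ z ∧ z < y ∧ x' ≤ z ∧ z < y') ∨ (y ≤ z ∧ z < x ∧ y' ≤ z ∧ z < x'))
    (h : RSat M.accepts u I x y) (h' : RSat M.accepts u I x' y')
    (hstate : M.eval ((annot u I x y).take z) = M.eval ((annot u I x' y').take z)) :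
    RSat M.accepts u I x' y := by
  have split (a b : ℕ) : RSat M.accepts u I a b ↔
      M.evalFrom (M.eval ((annot u I a b).take z)) ((annot u I a b).drop z) ∈ M.accept := by
    rw [DFA.eval, ← DFA.evalFrom_of_append, List.take_append_drop]
    rfl
  rw [split] at h h' ⊢
  rcases hcross with hc | hc
  · have htake : (annot u I x' y).take z = (annot u I x' y').take z := by
      apply List.ext_getElem
      · simp [annot]
      · intro i hi _
        simp only [annot, List.length_take, List.length_mapIdx] at hi
        simp only [annot, List.getElem_take, List.getElem_mapIdx, Prod.mk.injEq, true_and,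
          decide_eq_decide]
        omega
    have hdrop : (annot u I x' y).drop z = (annot u I x y).drop z := by
      apply List.ext_getElem
      · simp [annot]
      · intro i hi _
        simp only [annot, List.getElem_drop, List.getElem_mapIdx, Prod.mk.injEq, true_and,
          and_true, decide_eq_decide]
        omega
    rwa [htake, hdrop, ← hstate]
  · have htake : (annot u I x' y).take z = (annot u I x y).take z := by
      apply List.ext_getElem
      · simp [annot]
      · intro i hi _
        simp only [annot, List.length_take, List.length_mapIdx] at hi
        simp only [annot, List.getElem_take, List.getElem_mapIdx, Prod.mk.injEq, true_and,
          and_true, decide_eq_decide]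
        omega
    have hdrop : (annot u I x' y).drop z = (annot u I x' y').drop z := by
      apply List.ext_getElem
      · simp [annot]
      · intro i hi _
        simp only [annot, List.getElem_drop, List.getElem_mapIdx, Prod.mk.injEq, true_and,
          decide_eq_decide]
        omega
    rwa [htake, hdrop, hstate]

/-- `x` and `y` are positions of `u` with `(u, Ī, x, y) ⊨ γ`. -/
def RPair {Sig : Type} {m : ℕ} (γ : Set (List (RLetter Sig m))) (u : List Sig)
    (I : Fin m → ℕ → Bool) (x y : ℕ) : Prop :=
  1 ≤ x ∧ x ≤ u.length ∧ 1 ≤ y ∧ y ≤ u.length ∧ RSat γ u I x y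

theorem finite_setOf_exists_rPair_and {Sig : Type} {m : ℕ} (γ : Set (List (RLetter Sig m)))
    (u : List Sig) (I : Fin m → ℕ → Bool) (C : ℕ → ℕ → Prop) :
    {x | ∃ y, RPair γ u I x y ∧ C x y}.Finite :=
  (Set.finite_Icc 1 u.length).subset fun _ ⟨_, h, _⟩ => ⟨h.1, h.2.1⟩

theorem BoundedBy.ncard_setOf_rPair_and_le {Sig : Type} {m k : ℕ}
    {γ : Set (List (RLetter Sig m))} (hγ : BoundedBy γ k) (u : List Sig) (I : Fin m → ℕ → Bool)
    (C : ℕ → ℕ → Prop) (y : ℕ) : {x | RPair γ u I x y ∧ C x y}.ncard ≤ k := by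
  by_cases hy : 1 ≤ y ∧ y ≤ u.length
  · refine le_trans (Set.ncard_le_ncard ?_ ?_) (hγ u I y hy.1 hy.2)
    · exact fun x hx => ⟨hx.1.1, hx.1.2.1, hx.1.2.2.2.2⟩
    · exact (Set.finite_Icc 1 u.length).subset fun x hx => ⟨hx.1, hx.2.1⟩
  · have : {x | RPair γ u I x y ∧ C x y} = ∅ :=
      Set.eq_empty_of_forall_notMem fun x hx => hy ⟨hx.1.2.2.1, hx.1.2.2.2.1⟩
    simp [this]

theorem ncard_right_crossing_le {Sig Q : Type} [Fintype Q] {m k : ℕ}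
    (M : DFA (RLetter Sig m) Q) (hM : BoundedBy (Sig := Sig) M.accepts k) (u : List Sig)
    (I : Fin m → ℕ → Bool) (z : ℕ) :
    {x | ∃ y, RPair M.accepts u I x y ∧ x ≤ z ∧ z < y}.ncard ≤ k * Fintype.card Q := by
  refine ncard_sources_le (fun x y => M.eval ((annot u I x y).take z))
    (finite_setOf_exists_rPair_and _ u I _) (hM.ncard_setOf_rPair_and_le u I _) ?_
  rintro x y x' y' ⟨⟨-, -, hy, hyu, h⟩, hc⟩ ⟨⟨hx', hxu', -, -, h'⟩, hc'⟩ hl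
  exact ⟨⟨hx', hxu', hy, hyu, rSat_exchange M u I (by omega) h h' hl⟩, by omega⟩

theorem ncard_left_crossing_le {Sig Q : Type} [Fintype Q] {m k : ℕ}
    (M : DFA (RLetter Sig m) Q) (hM : BoundedBy (Sig := Sig) M.accepts k) (u : List Sig)
    (I : Fin m → ℕ → Bool) (z : ℕ) :
    {x | ∃ y, RPair M.accepts u I x y ∧ y ≤ z ∧ z < x}.ncard ≤ k * Fintype.card Q := by
  refine ncard_sources_le (fun x y => M.eval ((annot u I x y).take z))
    (finite_setOf_exists_rPair_and _ u I _) (hM.ncard_setOf_rPair_and_le u I _) ?_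
  rintro x y x' y' ⟨⟨-, -, hy, hyu, h⟩, hc⟩ ⟨⟨hx', hxu', -, -, h'⟩, hc'⟩ hl
  exact ⟨⟨hx', hxu', hy, hyu, rSat_exchange M u I (by omega) h h' hl⟩, by omega⟩

/-- Every bounded regular resynchronizer is, after a change of input parameters, simulated by
some `R_k`. -/
theorem exists_condK_of_rPair {Sig : Type} {m : ℕ} {γ : Set (List (RLetter Sig m))}
    (hreg : IsRegularLang γ) (hbdd : BoundedResync γ) :
    ∃ k, 1 ≤ k ∧ ∀ (u : List Sig) (I : Fin m → ℕ → Bool), ∃ J : Fin (2 * k) → ℕ → Bool,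
      ∀ x y, RPair γ u I x y → CondK k u J x y := by
  obtain ⟨Q, _, M, rfl⟩ := hreg
  obtain ⟨b, hb⟩ := hbdd
  set K := b * Fintype.card Q
  refine ⟨K + 1, by omega, fun u I => ?_⟩
  obtain ⟨cR, hcR⟩ := exists_greedy_coloring (K := K)
    (r := fun x z => ∃ y, RPair M.accepts u I x y ∧ x < z ∧ z ≤ y)
    (Subrelation.wf (r := (· < ·)) (fun ⟨_, _, h, _⟩ => h) Nat.lt_wfRel.wf)
    (fun z => finite_setOf_exists_rPair_and _ u I _)
    (fun z => by
      refine le_trans (Set.ncard_le_ncard ?_ (finite_setOf_exists_rPair_and _ u I _))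
        (ncard_right_crossing_le M hb u I (z - 1))
      exact fun x ⟨y, h, hxz, hzy⟩ => ⟨y, h, by omega, by omega⟩)
  obtain ⟨cL, hcL⟩ := exists_greedy_coloring (K := K)
    (r := fun x z => ∃ y, RPair M.accepts u I x y ∧ y ≤ z ∧ z < x)
    (Subrelation.wf (r := InvImage (· < ·) (u.length - ·))
      (fun ⟨_, h, _, hzx⟩ => by
        have := h.2.1
        simp only [InvImage]
        omega)
      (InvImage.wf _ Nat.lt_wfRel.wf))
    (fun z => finite_setOf_exists_rPair_and _ u I _)
    (ncard_left_crossing_le M hb u I)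
  refine ⟨fun i x => decide ((i : ℕ) = cR x ∨ (i : ℕ) = K + 1 + cL x), fun x y h => ?_⟩
  refine ⟨h.1, h.2.1, h.2.2.1, h.2.2.2.1, ?_⟩
  rcases lt_trichotomy x y with hxy | hxy | hxy
  · refine Or.inr (Or.inl ⟨⟨cR x, by omega⟩, (cR x).2, by simp, hxy, fun z hxz hzy => ?_⟩)
    have hne := Fin.val_ne_of_ne (hcR z x ⟨y, h, hxz, hzy⟩)
    have := (cR x).2
    simp only [decide_eq_false_iff_not]
    omega
  · exact Or.inl hxy
  · refine Or.inr (Or.inr ⟨⟨K + 1 + cL x, by omega⟩, by simp, by simp, hxy,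
      fun z hyz hzx => ?_⟩)
    have hne := Fin.val_ne_of_ne (hcL z x ⟨y, h, hyz, hzx⟩)
    have := (cR z).2
    simp only [decide_eq_false_iff_not]
    omega

/-- The resynchronizers `R_k` are universal: if `S₁ ⪯ S₂` is witnessed by some bounded
regular resynchronizer, then it is witnessed by `R_k` for some `k ≥ 1`. -/
theorem gammaK_universal (Sig Gam : Type) [Fintype Sig] [Fintype Gam]
    (S₁ S₂ : Set (OriginGraph Sig Gam)) (h : ResyncLE S₁ S₂) :
    ∃ k : ℕ, 1 ≤ k ∧ ContainedUpTo (gammaK Sig k) S₁ S₂ := by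
  obtain ⟨m, γ, hreg, hbdd, hcont⟩ := h
  obtain ⟨k, hk, hsim⟩ := exists_condK_of_rPair hreg hbdd
  refine ⟨k, hk, fun g₁ hg₁ => ?_⟩
  obtain ⟨g₂, hg₂, hinp, hout, I, hI⟩ := hcont g₁ hg₁
  obtain ⟨J, hJ⟩ := hsim g₂.inp I
  refine ⟨g₂, hg₂, hinp, hout, J, fun t ht htl => ⟨g₂.inp, J, _, _, rfl, hJ _ _ ?_⟩⟩
  have hsrc := g₂.orig_mem t ht (hout ▸ htl)
  have htgt := g₁.orig_mem t ht htl
  exact ⟨hsrc.1, hsrc.2, htgt.1, hinp ▸ htgt.2, hI t ht htl⟩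
end

section
/- Over Σ = Γ = {a}, for n ≥ 1 let σ_n = (a^{2n}, a^{2n}, orig) with orig(t) = t (the identity origin graph) and σ'_n = (a^{2n}, a^{2n}, orig') with orig'(t) = 2n+1−t (the reversal origin graph). Then in the pair (σ_n, σ'_n), the input position n is traversed by at least n distinct input positions; consequently, for every k ∈ ℕ there exists n such that (σ_n, σ'_n) does not have k-traversal. -/
/-- The identity origin graph on input `aⁿ` and output `aⁿ`. -/
def idGraph (n : ℕ) (h : 1 ≤ n) : OriginGraph Unit Unit where
  inp := List.replicate n ()
  out := List.replicate n ()
  orig := fun t => t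
  inp_ne := by simp only [ne_eq, List.replicate_eq_nil_iff]; omega
  orig_mem := by intro t h1 h2; simp only [List.length_replicate] at *; omega

/-- The reversal origin graph on input `aⁿ` and output `aⁿ`: `orig(t) = n + 1 - t`. -/
def revGraph (n : ℕ) (h : 1 ≤ n) : OriginGraph Unit Unit where
  inp := List.replicate n ()
  out := List.replicate n ()
  orig := fun t => n + 1 - t
  inp_ne := by simp only [ne_eq, List.replicate_eq_nil_iff]; omega
  orig_mem := by intro t h1 h2; simp only [List.length_replicate] at *; omega

theorem finite_setOf_traverses_idGraph (n : ℕ) (h : 1 ≤ n) (g : OriginGraph Unit Unit) (z : ℕ) :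
    {x : ℕ | Traverses (idGraph n h) g x z}.Finite := by
  refine (Set.finite_Icc 1 n).subset ?_
  rintro x ⟨t, h1, h2, rfl, -⟩
  exact ⟨h1, by simpa [idGraph] using h2⟩

theorem traverses_idGraph_revGraph_of_le {n x : ℕ} (h : 1 ≤ 2 * n) (hx : 1 ≤ x) (hxn : x ≤ n) :
    Traverses (idGraph (2 * n) h) (revGraph (2 * n) h) x n := by
  refine ⟨x, hx, ?_, rfl, Or.inl ⟨hxn, ?_⟩⟩
  · simp only [idGraph, List.length_replicate]
    omega
  · simp only [revGraph]
    omega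

theorem le_ncard_traverses_idGraph_revGraph (n : ℕ) (h : 1 ≤ 2 * n) :
    n ≤ {x : ℕ | Traverses (idGraph (2 * n) h) (revGraph (2 * n) h) x n}.ncard := by
  calc n = (Set.Icc 1 n).ncard := by
        rw [← Finset.coe_Icc, Set.ncard_coe_finset, Nat.card_Icc, Nat.add_sub_cancel]
    _ ≤ _ := Set.ncard_le_ncard
        (fun _ hx => traverses_idGraph_revGraph_of_le h hx.1 hx.2)
        (finite_setOf_traverses_idGraph _ h _ _)

/-- For the identity and reversal origin graphs on `(a^{2n}, a^{2n})`, the input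
position `n` is traversed by at least `n` distinct input positions; consequently, for
every `k` there is `n` such that the pair does not have `k`-traversal. -/
theorem idGraph_revGraph_traversal :
    (∀ (n : ℕ) (h : 1 ≤ n),
      n ≤ {x : ℕ | Traverses (idGraph (2 * n) (by omega)) (revGraph (2 * n) (by omega))
            x n}.ncard) ∧
    (∀ k : ℕ, ∃ (n : ℕ) (_ : 1 ≤ n),
      ¬ HasTraversal k (idGraph (2 * n) (by omega)) (revGraph (2 * n) (by omega))) := by
  refine ⟨fun n h => le_ncard_traverses_idGraph_revGraph n (by omega), fun k => ?_⟩
  refine ⟨k + 1, by omega, fun hk => ?_⟩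
  have hle := hk (k + 1) (by omega) (by simp only [idGraph, List.length_replicate]; omega)
  have hge := le_ncard_traverses_idGraph_revGraph (k + 1) (by omega)
  omega
end

section
/- Over Σ = Γ = {a}, let S_id = {(aⁿ, aⁿ, t ↦ t) : n ≥ 1} and S_rev = {(aⁿ, aⁿ, t ↦ n+1−t) : n ≥ 1} (the origin semantics of the two-way deterministic transducers T_id and T_rev computing the identity relation on a*). Then ¬(S_rev ⪯ S_id): there is no bounded regular resynchronizer R with S_rev ⊆ R(S_id). In particular, S_id and S_rev are not ∼-equivalent (where S₁ ∼ S₂ means S₁ ⪯ S₂ and S₂ ⪯ S₁), even though T_id and T_rev are classically equivalent. -/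
/-- The origin semantics of the two-way deterministic transducer `T_id` computing the
identity on `a*`. -/
def SId : Set (OriginGraph Unit Unit) := { g | ∃ (n : ℕ) (h : 1 ≤ n), g = idGraph n h }

/-- The origin semantics of the two-way deterministic transducer `T_rev`, also computing
the identity on `a*` but producing its output in reverse order. -/
def SRev : Set (OriginGraph Unit Unit) := { g | ∃ (n : ℕ) (h : 1 ≤ n), g = revGraph n h }

theorem annot_eq_take_append_drop {Sig : Type} {m : ℕ} (u : List Sig) (I : Fin m → ℕ → Bool)
    {x y x₀ y₀ h : ℕ} (hx : x ≤ h) (hx₀ : x₀ ≤ h) (hy : h < y) (hy₀ : h < y₀) :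
    annot u I x y = (annot u I x y₀).take h ++ (annot u I x₀ y).drop h := by
  rw [← List.take_append_drop h (annot u I x y)]
  congr 1
  · refine List.ext_getElem (by simp [annot]) fun i h₁ h₂ => ?_
    have hi : i < h := by simp only [List.length_take] at h₁; omega
    have e : (i + 1 = y) ↔ (i + 1 = y₀) := by omega
    simp [annot, e]
  · refine List.ext_getElem (by simp [annot]) fun i h₁ h₂ => ?_
    rcases i with _ | i
    · have hne : ∀ a ≤ h, h + 1 ≠ a := fun a _ => by omega
      simp [annot, hne x hx, hne x₀ hx₀]
    · have e : (h + (i + 1) + 1 = x) ↔ (h + (i + 1) + 1 = x₀) := by omega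
      simp [annot, e]

/-- Cut-and-paste bound: if the first half of `u` is paired with positions of its second half
through a language that is recognized by `M` and bounded by `k`, then that half has at most
`|Q| * k` positions. -/
theorem BoundedBy.le_card_mul {Sig Q : Type} [Fintype Q] {m k h : ℕ} {M : DFA (RLetter Sig m) Q}
    (hb : BoundedBy (M.accepts : Set (List (RLetter Sig m))) k) (u : List Sig)
    (I : Fin m → ℕ → Bool) (p : ℕ → ℕ) (hu : h < u.length)
    (hp : ∀ x, 1 ≤ x → x ≤ h → h < p x ∧ p x ≤ u.length ∧ RSat M.accepts u I x (p x)) :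
    h ≤ Fintype.card Q * k := by
  classical
  by_contra! hlt
  let f : ℕ → Q := fun x => M.eval ((annot u I x u.length).take h)
  obtain ⟨q, -, hq⟩ := Finset.exists_lt_card_fiber_of_mul_lt_card_of_maps_to
    (s := Finset.Icc 1 h) (t := Finset.univ) (f := f) (n := k)
    (fun _ _ => Finset.mem_univ _) (by simpa using hlt)
  obtain ⟨x₀, hx₀⟩ := Finset.card_pos.mp (Nat.zero_lt_of_lt hq)
  simp only [Finset.mem_filter, Finset.mem_Icc] at hx₀
  obtain ⟨⟨h1, h2⟩, hfx₀⟩ := hx₀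
  obtain ⟨hp1, hp2, hsat⟩ := hp x₀ h1 h2
  have hsub : (((Finset.Icc 1 h).filter fun x => f x = q : Finset ℕ) : Set ℕ) ⊆
      {x : ℕ | 1 ≤ x ∧ x ≤ u.length ∧ RSat M.accepts u I x (p x₀)} := by
    intro x hx
    simp only [Finset.coe_filter, Finset.mem_Icc, Set.mem_ofPred_eq] at hx
    obtain ⟨⟨h3, h4⟩, hfx⟩ := hx
    refine ⟨h3, by omega, ?_⟩
    have hs : M.eval (annot u I x₀ (p x₀)) ∈ M.accept := hsat
    change M.eval (annot u I x (p x₀)) ∈ M.accept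
    rw [annot_eq_take_append_drop u I h2 h2 hp1 hu, DFA.eval, DFA.evalFrom_of_append] at hs
    rw [annot_eq_take_append_drop u I h4 h2 hp1 hu, DFA.eval, DFA.evalFrom_of_append]
    have e : f x = f x₀ := hfx.trans hfx₀.symm
    simp only [f, DFA.eval] at e
    rwa [e]
  have hfin : {x : ℕ | 1 ≤ x ∧ x ≤ u.length ∧ RSat M.accepts u I x (p x₀)}.Finite :=
    (Set.finite_Icc 1 u.length).subset fun x hx => ⟨hx.1, hx.2.1⟩
  have hle := Set.ncard_le_ncard hsub hfin
  rw [Set.ncard_coe_finset] at hle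
  have := hb u I (p x₀) (by omega) hp2
  omega

theorem not_resyncLE_SRev_SId : ¬ ResyncLE SRev SId := by
  rintro ⟨m, γ, ⟨Q, _, M, rfl⟩, ⟨k, hb⟩, hc⟩
  let h := Fintype.card Q * k + 1
  obtain ⟨_, ⟨n, hn, rfl⟩, hinp, -, I, hI⟩ := hc (revGraph (h + h) (by omega)) ⟨_, _, rfl⟩
  obtain rfl : n = h + h := by simpa [idGraph, revGraph] using congrArg List.length hinp
  have := hb.le_card_mul (h := h) (List.replicate (h + h) ()) I (fun x => h + h + 1 - x)
    (by simp [h]) fun x h1 h2 =>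
      ⟨by omega, by simp only [List.length_replicate]; omega,
        hI x h1 (by simp only [revGraph, List.length_replicate]; omega)⟩
  omega

/-- There is no bounded regular resynchronizer `R` with `S_rev ⊆ R(S_id)`; in particular
`T_id` and `T_rev` are not `∼`-equivalent (although they are classically equivalent). -/
theorem id_rev_not_resyncLE :
    ¬ ResyncLE SRev SId ∧ ¬ (ResyncLE SId SRev ∧ ResyncLE SRev SId) :=
  ⟨not_resyncLE_SRev_SId, fun h => not_resyncLE_SRev_SId h.2⟩
end

section
/- For n ≥ 1, let σ_n be the unique element of S_one-two with input a^{2n} and output a^{3n} (namely orig_{2n,n}) and σ'_n the unique element of S_two-one with input a^{2n} and output a^{3n} (namely orig'_{2n,n}). Then for every k ∈ ℕ there exists n such that the pair (σ_n, σ'_n) does not have k-traversal, i.e., some input position is traversed by more than k distinct input positions. -/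
/-- The origin graph `(aⁿ, a^{2n-p}, orig_{n,p})` of the transducer `T_one-two`,
which copies each of the first `p` input letters once and each remaining input letter
twice: `orig_{n,p}(t) = t` for `t ≤ p` and `orig_{n,p}(p + j) = p + ⌈j/2⌉`. -/
def oneTwoGraph (n p : ℕ) (h1 : 1 ≤ n) (h2 : p ≤ n) : OriginGraph Unit Unit where
  inp := List.replicate n ()
  out := List.replicate (2 * n - p) ()
  orig := fun t => if t ≤ p then t else p + (t - p + 1) / 2
  inp_ne := by simp only [ne_eq, List.replicate_eq_nil_iff]; omega
  orig_mem := by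
    intro t ht1 ht2; simp only [List.length_replicate] at *
    split <;> omega

/-- The origin graph `(aⁿ, a^{n+q}, orig'_{n,q})` of the transducer `T_two-one`,
which copies each of the first `q` input letters twice and each remaining input letter
once: `orig'_{n,q}(t) = ⌈t/2⌉` for `t ≤ 2q` and `orig'_{n,q}(2q + j) = q + j`. -/
def twoOneGraph (n q : ℕ) (h1 : 1 ≤ n) (h2 : q ≤ n) : OriginGraph Unit Unit where
  inp := List.replicate n ()
  out := List.replicate (n + q) ()
  orig := fun t => if t ≤ 2 * q then (t + 1) / 2 else t - q
  inp_ne := by simp only [ne_eq, List.replicate_eq_nil_iff]; omega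
  orig_mem := by
    intro t ht1 ht2; simp only [List.length_replicate] at *
    split <;> omega

/-- Each position `x` with `z ≤ x ≤ n` and `x + 2 ≤ 2 * z` traverses `z` in the pair
`(orig_{2n,n}, orig'_{2n,n})`. -/
theorem traverses_oneTwo_twoOne {n x z : ℕ} (h : 1 ≤ 2 * n) (hn : n ≤ 2 * n)
    (hzx : z ≤ x) (hxn : x ≤ n) (hxz : x + 2 ≤ 2 * z) :
    Traverses (oneTwoGraph (2 * n) n h hn) (twoOneGraph (2 * n) n h hn) x z := by
  refine ⟨x, by omega, ?_, ?_, Or.inr ⟨?_, hzx⟩⟩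
  · simp only [oneTwoGraph, List.length_replicate]
    omega
  · simp only [oneTwoGraph, if_pos hxn]
  · simp only [twoOneGraph]
    split <;> omega

/-- For the unique origin graphs of `T_one-two` and `T_two-one` on input `a^{2n}` and
output `a^{3n}` (namely `orig_{2n,n}` and `orig'_{2n,n}`), the traversal is unbounded:
for every `k` there is `n` such that the pair does not have `k`-traversal. -/
theorem oneTwo_twoOne_traversal_unbounded :
    ∀ k : ℕ, ∃ (n : ℕ) (_ : 1 ≤ n),
      ¬ HasTraversal k (oneTwoGraph (2 * n) n (by omega) (by omega))
          (twoOneGraph (2 * n) n (by omega) (by omega)) := by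
  intro k
  refine ⟨2 * (k + 2), by omega, fun H => ?_⟩
  have hk := H (k + 2) (by omega) (by simp only [oneTwoGraph, List.length_replicate]; omega)
  refine absurd (le_trans ?_ hk) (Nat.not_succ_le_self k)
  calc k + 1 = (Set.Icc (k + 2) (2 * k + 2)).ncard := by
        rw [← Finset.coe_Icc, Set.ncard_coe_finset, Nat.card_Icc]
        omega
    _ ≤ _ := Set.ncard_le_ncard
        (fun x hx => traverses_oneTwo_twoOne _ _ hx.1 (by have := hx.2; omega)
          (by have := hx.2; omega))
        (finite_setOf_traverses _ _ _)
end

section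
/- ¬(S_two-one ⪯ S_one-two): there is no bounded regular resynchronizer R with S_two-one ⊆ R(S_one-two). In particular, the one-way nondeterministic transducers T_one-two and T_two-one, which have the same classical semantics {(aⁿ, aᵐ) : n ≤ m ≤ 2n}, are not ∼-equivalent (where S₁ ∼ S₂ means S₁ ⪯ S₂ and S₂ ⪯ S₁). -/
/-- The origin semantics of the one-way nondeterministic transducer `T_one-two`. -/
def SOneTwo : Set (OriginGraph Unit Unit) :=
  { g | ∃ (n p : ℕ) (h1 : 1 ≤ n) (h2 : p ≤ n), g = oneTwoGraph n p h1 h2 }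

/-- The origin semantics of the one-way nondeterministic transducer `T_two-one`. -/
def STwoOne : Set (OriginGraph Unit Unit) :=
  { g | ∃ (n q : ℕ) (h1 : 1 ≤ n) (h2 : q ≤ n), g = twoOneGraph n q h1 h2 }

theorem take_annot_congr_source {Sig : Type} {m : ℕ} (u : List Sig) (I : Fin m → ℕ → Bool)
    {c x x' : ℕ} (y : ℕ) (hx : c < x) (hx' : c < x') :
    (annot u I x y).take c = (annot u I x' y).take c := by
  apply List.ext_getElem
  · simp [annot]
  · intro i hi hi'
    simp only [List.length_take] at hi
    have h : i + 1 ≠ x := by omega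
    have h' : i + 1 ≠ x' := by omega
    simp [annot, h, h']

theorem drop_annot_congr_target {Sig : Type} {m : ℕ} (u : List Sig) (I : Fin m → ℕ → Bool)
    {c y y' : ℕ} (x : ℕ) (hy : y ≤ c) (hy' : y' ≤ c) :
    (annot u I x y).drop c = (annot u I x y').drop c := by
  apply List.ext_getElem
  · simp [annot]
  · intro i hi hi'
    have h : c + i + 1 ≠ y := by omega
    have h' : c + i + 1 ≠ y' := by omega
    simp [annot, h, h']

/-- A source can be paired with any target on the other side of a cut whose annotated prefix
leads the automaton to the same state. -/
theorem RSat.exchange {Sig Q : Type} {m : ℕ} {M : DFA (RLetter Sig m) Q} {u : List Sig}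
    {I : Fin m → ℕ → Bool} {c x x' y y' : ℕ} (hx : c < x) (hx' : c < x')
    (hy : y ≤ c) (hy' : y' ≤ c)
    (hstate : M.eval ((annot u I x y).take c) = M.eval ((annot u I x' y').take c))
    (h : RSat M.accepts u I x y) : RSat M.accepts u I x y' := by
  have key : M.eval (annot u I x y') = M.eval (annot u I x y) := by
    rw [← List.take_append_drop c (annot u I x y'), ← List.take_append_drop c (annot u I x y)]
    simp only [DFA.eval, DFA.evalFrom_of_append] at hstate ⊢
    rw [take_annot_congr_source u I y' hx hx', drop_annot_congr_target u I x hy' hy, hstate]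
  have h' : M.eval (annot u I x y) ∈ M.accept := h
  rw [← key] at h'
  exact h'

/-- In a bounded regular resynchronizer, boundedly many sources are redirected leftwards
across a given cut. -/
theorem BoundedBy.card_crossing_le {Sig Q : Type} [Fintype Q] {m k : ℕ}
    {M : DFA (RLetter Sig m) Q} (hk : BoundedBy (M.accepts : Set (List (RLetter Sig m))) k)
    (u : List Sig) (I : Fin m → ℕ → Bool) (c : ℕ) (target : ℕ → ℕ) (s : Finset ℕ)
    (hs : ∀ x ∈ s, c < x ∧ x ≤ u.length ∧ 1 ≤ target x ∧ target x ≤ c ∧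
      RSat M.accepts u I x (target x)) :
    s.card ≤ Fintype.card Q * k := by
  classical
  by_contra! hlt
  obtain ⟨q, -, hq⟩ := Finset.exists_lt_card_fiber_of_mul_lt_card_of_maps_to
    (s := s) (t := Finset.univ) (f := fun x => M.eval ((annot u I x (target x)).take c))
    (fun _ _ => Finset.mem_univ _) (by simpa using hlt)
  set F := {x ∈ s | M.eval ((annot u I x (target x)).take c) = q} with hF
  obtain ⟨x₀, hx₀⟩ : F.Nonempty := Finset.card_pos.mp (by omega)
  obtain ⟨hx₀s, hx₀q⟩ := Finset.mem_filter.mp hx₀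
  obtain ⟨hc₀, hlen₀, hpos₀, hle₀, -⟩ := hs x₀ hx₀s
  have hbound := hk u I (target x₀) hpos₀ (by omega)
  have hsub : (F : Set ℕ) ⊆
      {x | 1 ≤ x ∧ x ≤ u.length ∧ RSat M.accepts u I x (target x₀)} := by
    intro x hx
    obtain ⟨hxs, hxq⟩ := Finset.mem_filter.mp (Finset.mem_coe.mp hx)
    obtain ⟨hc, hlen, -, hle, hsat⟩ := hs x hxs
    exact ⟨by omega, hlen, hsat.exchange hc hc₀ hle hle₀ (hxq.trans hx₀q.symm)⟩
  have hcard := Set.ncard_le_ncard hsub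
    ((Set.finite_Iic u.length).subset fun x hx => hx.2.1)
  rw [Set.ncard_coe_finset] at hcard
  omega

theorem not_resyncLE_sTwoOne_sOneTwo : ¬ ResyncLE STwoOne SOneTwo := by
  rintro ⟨m, γ, ⟨Q, _, M, rfl⟩, ⟨k, hk⟩, hcont⟩
  set N := Fintype.card Q * k + 1 with hN
  obtain ⟨g, ⟨n, p, hn, hp, rfl⟩, hinp, hout, I, hI⟩ :=
    hcont (twoOneGraph (3 * N) N (by omega) (by omega)) ⟨_, _, _, _, rfl⟩
  obtain rfl : n = 3 * N := by
    simpa [oneTwoGraph, twoOneGraph] using congrArg List.length hinp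
  obtain rfl : p = 2 * N := by
    have h : 2 * (3 * N) - p = 3 * N + N := by
      simpa only [oneTwoGraph, twoOneGraph, List.length_replicate]
        using congrArg List.length hout
    omega
  have hcard := hk.card_crossing_le (List.replicate (3 * N) ()) I N (fun x => (x + 1) / 2)
    (Finset.Ioc N (2 * N)) (by
      intro x hx
      obtain ⟨hx1, hx2⟩ := Finset.mem_Ioc.mp hx
      refine ⟨hx1, by rw [List.length_replicate]; omega, by omega, by omega, ?_⟩
      have h := hI x (by omega) (by simp only [twoOneGraph, List.length_replicate]; omega)
      simpa only [oneTwoGraph, twoOneGraph, if_pos hx2] using h)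
  rw [Nat.card_Ioc] at hcard
  omega

/-- There is no bounded regular resynchronizer `R` with `S_two-one ⊆ R(S_one-two)`;
in particular `T_one-two` and `T_two-one` (which have the same classical semantics
`{(aⁿ, aᵐ) : n ≤ m ≤ 2n}`) are not `∼`-equivalent. -/
theorem oneTwo_twoOne_not_resyncLE :
    ¬ ResyncLE STwoOne SOneTwo ∧ ¬ (ResyncLE STwoOne SOneTwo ∧ ResyncLE SOneTwo STwoOne) := by
  exact ⟨not_resyncLE_sTwoOne_sOneTwo, fun h => not_resyncLE_sTwoOne_sOneTwo h.1⟩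
end

section
/- The problem BoundTape is undecidable: there is no algorithm (computable predicate on codes of machines) that decides, given a deterministic Turing machine M, whether M uses only a bounded portion of its tape when run on the empty (all-blank) input. (Proved by reduction from the halting problem on empty input: from M one constructs M' which writes the full computation history of M on its tape, so that M halts on empty input iff M' ∈ BoundTape.) -/
/-- A deterministic Turing machine, given by its (finite) transition table: an entry
`((q, a), (q', b, d))` means: in state `q` reading symbol `a`, switch to state `q'`,
write `b` and move right if `d = true`, left if `d = false`. States and tape symbols
are natural numbers; the initial state is `0` and the blank symbol is `0`; the machine
halts when no entry of the table applies. -/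
abbrev DTM : Type := List ((ℕ × ℕ) × (ℕ × ℕ × Bool))

/-- A configuration of a Turing machine: current state, tape content, head position. -/
structure TMConfig where
  state : ℕ
  tape : ℤ → ℕ
  pos : ℤ

/-- One computation step (the identity if the machine has halted). -/
def tmStep (M : DTM) (c : TMConfig) : TMConfig :=
  match M.find? (fun e => decide (e.1 = (c.state, c.tape c.pos))) with
  | none => c
  | some e =>
      { state := e.2.1
        tape := Function.update c.tape c.pos e.2.2.1
        pos := if e.2.2.2 then c.pos + 1 else c.pos - 1 }

/-- The initial configuration: initial state `0` on the all-blank tape. -/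
def tmInit : TMConfig := ⟨0, fun _ => 0, 0⟩

/-- The configuration reached after `n` steps of the run on the empty (all-blank) input. -/
def tmRun (M : DTM) (n : ℕ) : TMConfig := (tmStep M)^[n] tmInit

/-- `M ∈ BoundTape`: throughout the run of `M` on the empty input, the head stays
within distance `K` of the starting cell, for some `K`. -/
def BoundTape (M : DTM) : Prop := ∃ K : ℕ, ∀ n : ℕ, (tmRun M n).pos.natAbs ≤ K

/-! ### Machines over arbitrary state and symbol types -/

namespace SpaceTM

/-- One step of the machine with transition function `δ` on a triple
(state, tape content, head position); the identity if `δ` is undefined. -/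
def step {Q A : Type} (δ : Q → A → Option (Q × A × Bool)) (c : Q × (ℤ → A) × ℤ) :
    Q × (ℤ → A) × ℤ :=
  match δ c.1 (c.2.1 c.2.2) with
  | none => c
  | some r => (r.1, Function.update c.2.1 c.2.2 r.2.1, if r.2.2 then c.2.2 + 1 else c.2.2 - 1)

/-- Encoding of a configuration by natural numbers. -/
def encCfg {Q A : Type} (e : Q → ℕ) (g : A → ℕ) (c : Q × (ℤ → A) × ℤ) : TMConfig :=
  ⟨e c.1, fun z => g (c.2.1 z), c.2.2⟩

theorem exists_table {Q A : Type} [Finite A] (e : Q → ℕ) (g : A → ℕ) {S : Set Q}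
    (hS : S.Finite) (he : Set.InjOn e S) (hg : Function.Injective g)
    (δ : Q → A → Option (Q × A × Bool)) :
    ∃ T : DTM, ∀ q ∈ S, ∀ a, T.find? (fun x => decide (x.1 = (e q, g a))) =
      (δ q a).map fun r => ((e q, g a), (e r.1, g r.2.1, r.2.2)) := by
  obtain ⟨L, hL⟩ : ∃ L : List (Q × A), ∀ x, x ∈ L ↔ x.1 ∈ S := by
    have hfin : (S ×ˢ (Set.univ : Set A)).Finite := hS.prod Set.finite_univ
    refine ⟨hfin.toFinset.toList, fun x => ?_⟩
    simp
  refine ⟨L.filterMap fun x => (δ x.1 x.2).map fun r =>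
    ((e x.1, g x.2), (e r.1, g r.2.1, r.2.2)), fun q hq a => ?_⟩
  rw [List.find?_filterMap]
  cases hδ : δ q a with
  | none =>
    have : L.find? (fun x => ((δ x.1 x.2).map fun r =>
        ((e x.1, g x.2), (e r.1, g r.2.1, r.2.2))).any
          fun x => decide (x.1 = (e q, g a))) = none := by
      rw [List.find?_eq_none]
      rintro ⟨q', a'⟩ hx h
      have hq' := (hL _).1 hx
      simp only [Option.any_map, Option.any_eq_true, decide_eq_true_eq,
        Prod.mk.injEq] at h
      obtain ⟨r, hr, h1, h2⟩ := h
      obtain rfl := he hq' hq h1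
      obtain rfl := hg h2
      simp [hδ] at hr
    rw [this]; rfl
  | some r =>
    cases hf : L.find? (fun x => ((δ x.1 x.2).map fun r =>
        ((e x.1, g x.2), (e r.1, g r.2.1, r.2.2))).any
          fun x => decide (x.1 = (e q, g a))) with
    | none =>
      rw [List.find?_eq_none] at hf
      exact absurd (by simp [hδ]) (hf (q, a) ((hL _).2 hq))
    | some x =>
      obtain ⟨q', a'⟩ := x
      have hq' := (hL _).1 (List.mem_of_find?_eq_some hf)
      have h := List.find?_some hf
      simp only [Option.any_map, Option.any_eq_true, decide_eq_true_eq,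
        Prod.mk.injEq] at h
      obtain ⟨r', hr, h1, h2⟩ := h
      obtain rfl := he hq' hq h1
      obtain rfl := hg h2
      simp [hδ]

theorem tmStep_encCfg {Q A : Type} {e : Q → ℕ} {g : A → ℕ} {S : Set Q}
    {δ : Q → A → Option (Q × A × Bool)} {T : DTM}
    (hT : ∀ q ∈ S, ∀ a, T.find? (fun x => decide (x.1 = (e q, g a))) =
      (δ q a).map fun r => ((e q, g a), (e r.1, g r.2.1, r.2.2)))
    (c : Q × (ℤ → A) × ℤ) (hc : c.1 ∈ S) :
    tmStep T (encCfg e g c) = encCfg e g (step δ c) := by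
  obtain ⟨q, t, p⟩ := c
  have h : T.find? (fun x => decide (x.1 = ((encCfg e g (q, t, p)).state,
      (encCfg e g (q, t, p)).tape (encCfg e g (q, t, p)).pos))) = _ := hT q hc (t p)
  unfold tmStep
  rw [h]
  cases hδ : δ q (t p) with
  | none => simp only [encCfg, step, hδ, Option.map_none]
  | some r =>
    simp only [encCfg, step, hδ, Option.map_some, TMConfig.mk.injEq, true_and, and_true]
    funext z
    by_cases hz : z = p
    · subst hz; simp
    · simp [Function.update_of_ne hz]

theorem tmStep_iterate_encCfg {Q A : Type} {e : Q → ℕ} {g : A → ℕ} {S : Set Q}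
    {δ : Q → A → Option (Q × A × Bool)} {T : DTM}
    (hT : ∀ q ∈ S, ∀ a, T.find? (fun x => decide (x.1 = (e q, g a))) =
      (δ q a).map fun r => ((e q, g a), (e r.1, g r.2.1, r.2.2)))
    (hS : ∀ c, c.1 ∈ S → (step δ c).1 ∈ S)
    (c : Q × (ℤ → A) × ℤ) (hc : c.1 ∈ S) (n : ℕ) :
    (tmStep T)^[n] (encCfg e g c) = encCfg e g ((step δ)^[n] c) := by
  induction n generalizing c with
  | zero => rfl
  | succ n ih =>
    rw [Function.iterate_succ_apply, Function.iterate_succ_apply, tmStep_encCfg hT c hc,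
      ih _ (hS c hc)]

/-- `c'` is reached from `c` after finitely many steps. -/
def Reach {Q A : Type} (δ : Q → A → Option (Q × A × Bool)) (c c' : Q × (ℤ → A) × ℤ) : Prop :=
  ∃ n, (step δ)^[n] c = c'

theorem Reach.trans {Q A : Type} {δ : Q → A → Option (Q × A × Bool)} {a b c}
    (h₁ : Reach δ a b) (h₂ : Reach δ b c) : Reach δ a c := by
  obtain ⟨m, rfl⟩ := h₁
  obtain ⟨n, rfl⟩ := h₂
  exact ⟨n + m, Function.iterate_add_apply _ _ _ _⟩

theorem Reach.single {Q A : Type} {δ : Q → A → Option (Q × A × Bool)} {a b}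
    (h : step δ a = b) : Reach δ a b := ⟨1, h⟩

theorem reach_sweep_right {Q A : Type} {δ : Q → A → Option (Q × A × Bool)} {q : Q} {t : ℤ → A}
    {x y : ℤ} (hxy : x ≤ y) (h : ∀ z, x ≤ z → z < y → δ q (t z) = some (q, t z, true)) :
    Reach δ (q, t, x) (q, t, y) := by
  induction y, hxy using Int.leInduction with
  | base => exact ⟨0, rfl⟩
  | succ y hxy ih =>
    refine (ih fun z h₁ h₂ => h z h₁ (by omega)).trans (.single ?_)
    simp [step, h y hxy (by omega)]

theorem reach_sweep_left {Q A : Type} {δ : Q → A → Option (Q × A × Bool)} {q : Q} {t : ℤ → A}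
    {x y : ℤ} (hxy : x ≤ y) (h : ∀ z, x < z → z ≤ y → δ q (t z) = some (q, t z, false)) :
    Reach δ (q, t, y) (q, t, x) := by
  induction y, hxy using Int.leInduction with
  | base => exact ⟨0, rfl⟩
  | succ y hxy ih =>
    refine Reach.trans (.single ?_) (ih fun z h₁ h₂ => h z h₁ (by omega))
    simp [step, h (y + 1) (by omega) (by omega)]

/-! ### Simulating a machine while consuming one new tape cell per step -/

/-- The phases of the simulation of one step: `run` performs the step, `mark` marks the new head
position, `right` walks to the end marker, `place` writes the shifted end marker, `left` walks back
to the mark and `back` corrects the head position by one. -/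
inductive Phase
  | run | mark | right | place | left | back

instance : Finite Phase :=
  Finite.of_injective (β := Fin 6)
    (fun | .run => 0 | .mark => 1 | .right => 2 | .place => 3 | .left => 4 | .back => 5)
    (by intro a b h; cases a <;> cases b <;> simp_all)

/-- The transition function of the simulation of `M`. Symbols of `M` carry a Boolean mark, and
`none` is the end marker. -/
def simδ {Γ Λ : Type} [Inhabited Γ] [Inhabited Λ] (M : Turing.TM0.Machine Γ Λ) :
    Phase × Λ → Option (Γ × Bool) → Option ((Phase × Λ) × Option (Γ × Bool) × Bool)
  | (.run, q), some (a, _) =>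
    match M q a with
    | none => none
    | some (q', .move .left) => some ((.mark, q'), some (a, false), false)
    | some (q', .move .right) => some ((.mark, q'), some (a, false), true)
    | some (q', .write b) => some ((.right, q'), some (b, true), true)
  | (.mark, q), some (a, _) => some ((.right, q), some (a, true), true)
  | (.right, q), some (a, b) => some ((.right, q), some (a, b), true)
  | (.right, q), none => some ((.place, q), some (default, false), true)
  | (.place, q), _ => some ((.left, q), none, false)
  | (.left, q), some (a, false) => some ((.left, q), some (a, false), false)
  | (.left, q), some (a, true) => some ((.back, q), some (a, false), true)
  | (.back, q), x => some ((.run, q), x, false)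
  | _, none => none

section

variable {Γ Λ : Type} [Inhabited Γ] [Inhabited Λ] (M : Turing.TM0.Machine Γ Λ)

/-- The tape with content `F` and end marker at `k`. -/
def plainTape (F : ℤ → Γ) (k : ℤ) : ℤ → Option (Γ × Bool) :=
  fun z => if z = k then none else some (F z, false)

/-- The tape with content `F`, end marker at `k` and the cell `p` marked. -/
def markedTape (F : ℤ → Γ) (k p : ℤ) : ℤ → Option (Γ × Bool) :=
  fun z => if z = k then none else some (F z, decide (z = p))

theorem reach_place {F : ℤ → Γ} {k p : ℤ} (hp : p < k) (q : Λ) :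
    Reach (simδ M) ((.right, q), markedTape F k p, p + 1)
      ((.place, q), Function.update (markedTape F k p) k (some (default, false)), k + 1) := by
  refine (reach_sweep_right (y := k) (by omega) fun z h₁ h₂ => ?_).trans (.single ?_)
  · simp [markedTape, h₂.ne, simδ]
  · simp [step, markedTape, simδ]

theorem reach_run {F : ℤ → Γ} {k p : ℤ} (hp : p < k) (hF : ∀ z, k ≤ z → F z = default) (q : Λ) :
    Reach (simδ M)
      ((.place, q), Function.update (markedTape F k p) k (some (default, false)), k + 1)
      ((.run, q), plainTape F (k + 1), p) := by
  have h₁ : step (simδ M)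
      ((.place, q), Function.update (markedTape F k p) k (some (default, false)), k + 1) =
      ((.left, q), markedTape F (k + 1) p, k) := by
    simp only [step, simδ, Prod.mk.injEq, true_and]
    refine ⟨?_, by simp⟩
    funext z
    by_cases h : z = k + 1
    · subst h; simp [markedTape]
    · rw [Function.update_of_ne h]
      by_cases h' : z = k
      · subst h'; simp [markedTape, hF z le_rfl, hp.ne']
      · rw [Function.update_of_ne h']; simp [markedTape, h, h']
  have h₂ : Reach (simδ M) ((.left, q), markedTape F (k + 1) p, k)
      ((.left, q), markedTape F (k + 1) p, p) := by
    refine reach_sweep_left hp.le fun z h₁ h₂ => ?_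
    have : z ≠ k + 1 := by omega
    simp [markedTape, this, h₁.ne', simδ]
  have hpk : p ≠ k + 1 := by omega
  have h₃ : step (simδ M) ((.left, q), markedTape F (k + 1) p, p) =
      ((.back, q), plainTape F (k + 1), p + 1) := by
    simp only [step, markedTape, hpk, simδ]
    simp only [if_false, decide_true, if_true, Prod.mk.injEq, true_and, and_true]
    funext z
    by_cases h : z = p
    · subst h; simp [plainTape, hpk]
    · rw [Function.update_of_ne h]; simp [plainTape, markedTape, h]
  have h₄ : step (simδ M) ((.back, q), plainTape F (k + 1), p + 1) =
      ((.run, q), plainTape F (k + 1), p) := by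
    simp [step, simδ]
  exact (Reach.single h₁).trans (h₂.trans ((Reach.single h₃).trans (.single h₄)))

theorem step_mark {F : ℤ → Γ} {k p : ℤ} (hp : p < k) (q : Λ) :
    step (simδ M) ((.mark, q), plainTape F k, p) = ((.right, q), markedTape F k p, p + 1) := by
  simp only [step, plainTape, hp.ne, simδ]
  simp only [if_false, if_true, Prod.mk.injEq, true_and, and_true]
  funext z
  by_cases h : z = p
  · subst h; simp [markedTape, hp.ne]
  · rw [Function.update_of_ne h]; simp [plainTape, markedTape, h]

/-- The simulation's configuration for `c`, with head position `p` and end marker at `k`. -/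
def rep (c : Turing.TM0.Cfg Γ Λ) (p k : ℤ) : (Phase × Λ) × (ℤ → Option (Γ × Bool)) × ℤ :=
  ((.run, c.q), plainTape (fun z => c.Tape.nth (z - p)) k, p)

theorem step_rep_of_halted {c : Turing.TM0.Cfg Γ Λ} {p k : ℤ} (hp : p < k)
    (hc : Turing.TM0.step M c = none) : step (simδ M) (rep c p k) = rep c p k := by
  obtain ⟨q, T⟩ := c
  have hM : M q T.head = none := by simpa [Turing.TM0.step] using hc
  simp [step, rep, plainTape, hp.ne, simδ, hM]

theorem reach_rep_of_step {c c' : Turing.TM0.Cfg Γ Λ} {p k : ℤ} (hp : p + 2 ≤ k)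
    (hF : ∀ z, k ≤ z → c.Tape.nth (z - p) = default) (hc : c' ∈ Turing.TM0.step M c) :
    ∃ m p', Reach (simδ M) (rep c p k) m ∧ m.2.2 = k + 1 ∧ Reach (simδ M) m (rep c' p' (k + 1)) ∧
      p' + 2 ≤ k + 1 ∧ ∀ z, k + 1 ≤ z → c'.Tape.nth (z - p') = default := by
  obtain ⟨q, T⟩ := c
  obtain ⟨⟨q', s⟩, hM, rfl⟩ := Option.map_eq_some_iff.1 hc
  have hpk : p ≠ k := by omega
  cases s with
  | move d =>
    have key : ∀ p' : ℤ, p' < k → (∀ z, (T.move d).nth (z - p') = T.nth (z - p)) →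
        step (simδ M) (rep ⟨q, T⟩ p k) =
          ((.mark, q'), plainTape (fun z => T.nth (z - p)) k, p') →
        ∃ m p', Reach (simδ M) (rep ⟨q, T⟩ p k) m ∧ m.2.2 = k + 1 ∧
          Reach (simδ M) m (rep ⟨q', T.move d⟩ p' (k + 1)) ∧
          p' + 2 ≤ k + 1 ∧ ∀ z, k + 1 ≤ z → (T.move d).nth (z - p') = default := by
      intro p' hp' hT hs
      refine ⟨_, p', ((Reach.single hs).trans (.single (step_mark M hp' q'))).trans
        (reach_place M hp' q'), rfl, ?_, by omega, fun z hz => ?_⟩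
      · simp only [rep, hT]
        exact reach_run M hp' hF q'
      · rw [hT]; exact hF z (by omega)
    have hupd : Function.update (plainTape (fun z => T.nth (z - p)) k) p
        (some (T.head, false)) = plainTape (fun z => T.nth (z - p)) k := by
      rw [Function.update_eq_self_iff]; simp [plainTape, hpk]
    cases d with
    | left =>
      refine key (p - 1) (by omega) (fun z => ?_) ?_
      · rw [Turing.Tape.move_left_nth]; congr 1; ring
      · rw [← hupd]; simp [step, rep, plainTape, hpk, simδ, hM]
    | right =>
      refine key (p + 1) (by omega) (fun z => ?_) ?_
      · rw [Turing.Tape.move_right_nth]; congr 1; ring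
      · rw [← hupd]; simp [step, rep, plainTape, hpk, simδ, hM]
  | write b =>
    have hs : step (simδ M) (rep ⟨q, T⟩ p k) =
        ((.right, q'), markedTape (fun z => (T.write b).nth (z - p)) k p, p + 1) := by
      simp only [step, rep, plainTape, hpk, simδ, if_false, sub_self, Turing.Tape.nth_zero, hM]
      simp only [if_true, Prod.mk.injEq, true_and, and_true]
      funext z
      by_cases h : z = p
      · subst h; simp [markedTape, hpk, Turing.Tape.write]
      · rw [Function.update_of_ne h]
        have : z - p ≠ 0 := sub_ne_zero.2 h
        simp [plainTape, markedTape, h, Turing.Tape.write_nth, this]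
    have hF' : ∀ z, k ≤ z → (T.write b).nth (z - p) = default := by
      intro z hz
      rw [Turing.Tape.write_nth, if_neg (by omega)]
      exact hF z hz
    exact ⟨_, p, (Reach.single hs).trans (reach_place M (by omega) q'), rfl,
      reach_run M (by omega) hF' q', by omega, fun z hz => hF' z (by omega)⟩

theorem step_simδ_supports {S : Set Λ} (hS : Turing.TM0.Supports M S)
    (c : (Phase × Λ) × (ℤ → Option (Γ × Bool)) × ℤ) (hc : c.1.2 ∈ S) :
    (step (simδ M) c).1.2 ∈ S := by
  obtain ⟨⟨ph, q⟩, t, p⟩ := c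
  simp only [step]
  generalize t p = x
  rcases ph <;> rcases x with _ | ⟨a, _ | _⟩ <;> simp only [simδ] <;> try exact hc
  all_goals
    rcases h : M q a with _ | ⟨q', (_ | _) | b⟩
    · exact hc
    all_goals exact hS.2 h hc

theorem reach_rep_of_reaches {c c' : Turing.TM0.Cfg Γ Λ} {p k : ℤ} (hp : p + 2 ≤ k)
    (hF : ∀ z, k ≤ z → c.Tape.nth (z - p) = default)
    (h : StateTransition.Reaches (Turing.TM0.step M) c c') :
    ∃ p' k', Reach (simδ M) (rep c p k) (rep c' p' k') ∧ p' < k' := by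
  induction h using Relation.ReflTransGen.head_induction_on generalizing p k with
  | refl => exact ⟨p, k, ⟨0, rfl⟩, by omega⟩
  | head hab _ ih =>
    obtain ⟨m, p₁, h₁, -, h₂, hp₁, hF₁⟩ := reach_rep_of_step M hp hF hab
    obtain ⟨p', k', h₃, hk⟩ := ih hp₁ hF₁
    exact ⟨p', k', (h₁.trans h₂).trans h₃, hk⟩

theorem exists_reach_far {c : Turing.TM0.Cfg Γ Λ} {p k : ℤ} (hp : p + 2 ≤ k)
    (hF : ∀ z, k ≤ z → c.Tape.nth (z - p) = default)
    (h : ¬ (StateTransition.eval (Turing.TM0.step M) c).Dom) (n : ℕ) :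
    ∃ m, Reach (simδ M) (rep c p k) m ∧ m.2.2 = k + 1 + n := by
  have hstep : ∃ c', c' ∈ Turing.TM0.step M c := by
    by_contra hno
    refine h (Part.dom_iff_mem.2 ⟨c, StateTransition.mem_eval.2 ⟨.refl, ?_⟩⟩)
    exact Option.eq_none_iff_forall_not_mem.2 fun a ha => hno ⟨a, ha⟩
  obtain ⟨c', hc'⟩ := hstep
  obtain ⟨m, p₁, h₁, hm, h₂, hp₁, hF₁⟩ := reach_rep_of_step M hp hF hc'
  induction n generalizing c p k c' m p₁ with
  | zero => exact ⟨m, h₁, by simpa using hm⟩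
  | succ n ih =>
    have h' : ¬ (StateTransition.eval (Turing.TM0.step M) c').Dom := by
      rwa [← StateTransition.reaches_eval (Relation.ReflTransGen.single hc')]
    have hstep : ∃ c'', c'' ∈ Turing.TM0.step M c' := by
      by_contra hno
      refine h' (Part.dom_iff_mem.2 ⟨c', StateTransition.mem_eval.2 ⟨.refl, ?_⟩⟩)
      exact Option.eq_none_iff_forall_not_mem.2 fun a ha => hno ⟨a, ha⟩
    obtain ⟨c'', hc''⟩ := hstep
    obtain ⟨m', p₂, h₁', hm', h₂', hp₂, hF₂⟩ := reach_rep_of_step M hp₁ hF₁ hc''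
    obtain ⟨m'', h₃, hm''⟩ := ih hp₁ hF₁ h' c'' hc'' m' p₂ h₁' hm' h₂' hp₂ hF₂
    exact ⟨m'', (h₁.trans h₂).trans h₃, by rw [hm'']; push_cast; ring⟩

end

/-! ### Writing the input -/

/-- A table that writes the word `w` from right to left, using even states, and then enters
state `s` on the last written cell. -/
def writer (s : ℕ) (w : List ℕ) : DTM :=
  (List.range w.length).map (fun i => ((2 * i, 0), (2 * (i + 1), w.getD i 0, false))) ++
    [((2 * w.length, 0), (s, 0, true))]

theorem find?_writer_append_odd (s : ℕ) (w : List ℕ) (T : DTM) (x a : ℕ) :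
    (writer s w ++ T).find? (fun y => decide (y.1 = (2 * x + 1, a))) =
      T.find? (fun y => decide (y.1 = (2 * x + 1, a))) := by
  have : (writer s w).find? (fun y => decide (y.1 = (2 * x + 1, a))) = none := by
    rw [List.find?_eq_none]
    intro y hy h
    simp only [writer, List.mem_append, List.mem_map, List.mem_singleton] at hy
    simp only [decide_eq_true_eq] at h
    obtain ⟨i, -, rfl⟩ | rfl := hy <;> (simp only [Prod.mk.injEq] at h; omega)
  rw [List.find?_append, this, Option.none_or]

/-- The tape after the first `i` letters of `w` have been written. -/
def writtenTape (w : List ℕ) (i : ℕ) : ℤ → ℕ :=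
  fun z => if -(i : ℤ) < z ∧ z ≤ 0 then w.getD (-z).toNat 0 else 0

theorem tmRun_writer (s : ℕ) (w : List ℕ) (T : DTM) {i : ℕ} (hi : i ≤ w.length) :
    tmRun (writer s w ++ T) i = ⟨2 * i, writtenTape w i, -i⟩ := by
  induction i with
  | zero =>
    simp only [tmRun, Function.iterate_zero, id, tmInit, TMConfig.mk.injEq]
    refine ⟨by simp, ?_, by simp⟩
    funext z
    rw [writtenTape, if_neg (by push_cast; omega)]
  | succ i ih =>
    have hf : (writer s w ++ T).find? (fun y => decide (y.1 = (2 * i, 0))) =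
        some ((2 * i, 0), (2 * (i + 1), w.getD i 0, false)) := by
      have : (List.range w.length).find? (fun j => decide (2 * j = 2 * i)) = some i := by
        rw [List.find?_range_eq_some]
        refine ⟨by simp, by simpa using hi, fun j hj => ?_⟩
        simp only [Bool.not_eq_true', decide_eq_false_iff_not]
        omega
      simp only [writer, List.append_assoc, List.find?_append, List.find?_map, Function.comp_def,
        Prod.mk.injEq, and_true, this, Option.map_some, Option.some_or]
    have hz : writtenTape w i (-i) = 0 := by rw [writtenTape, if_neg (by omega)]
    rw [tmRun, Function.iterate_succ_apply', ← tmRun, ih (by omega)]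
    simp only [tmStep, hz, hf, TMConfig.mk.injEq, true_and]
    refine ⟨?_, by push_cast; simp; ring⟩
    funext z
    by_cases h : z = -(i : ℤ)
    · subst h
      rw [Function.update_self, writtenTape, if_pos (by push_cast; omega)]
      simp
    · rw [Function.update_of_ne h, writtenTape, writtenTape]
      congr 1
      simp only [eq_iff_iff]
      push_cast
      omega

theorem tmRun_writer_length_succ (s : ℕ) (w : List ℕ) (T : DTM) :
    tmRun (writer s w ++ T) (w.length + 1) = ⟨s, writtenTape w w.length, -w.length + 1⟩ := by
  have hf : (writer s w ++ T).find? (fun y => decide (y.1 = (2 * w.length, 0))) =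
      some ((2 * w.length, 0), (s, 0, true)) := by
    have : (List.range w.length).find? (fun j => decide (2 * j = 2 * w.length)) = none := by
      rw [List.find?_range_eq_none]
      intro j hj
      simp only [Bool.not_eq_true', decide_eq_false_iff_not]
      omega
    simp only [writer, List.find?_append, List.find?_map, Function.comp_def, Prod.mk.injEq,
      and_true, this]
    simp
  have hz : writtenTape w w.length (-w.length) = 0 := by rw [writtenTape, if_neg (by omega)]
  rw [tmRun, Function.iterate_succ_apply', ← tmRun, tmRun_writer s w T le_rfl]
  simp only [tmStep, hz, hf, TMConfig.mk.injEq, true_and, if_true, and_true]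
  rw [Function.update_eq_self_iff, hz]

/-! ### Bounded tape use as halting -/

theorem boundTape_of_tmStep_eq {T : DTM} {n : ℕ} (h : tmStep T (tmRun T n) = tmRun T n) :
    BoundTape T := by
  have hstab : ∀ m, tmRun T (n + m) = tmRun T n := by
    intro m
    induction m with
    | zero => rfl
    | succ m ih => rw [← add_assoc, tmRun, Function.iterate_succ_apply', ← tmRun, ih, h]
  refine ⟨(Finset.range (n + 1)).sup fun i => (tmRun T i).pos.natAbs, fun i => ?_⟩
  obtain hi | hi := le_total i n
  · exact Finset.le_sup (f := fun i => (tmRun T i).pos.natAbs) (by simpa using by omega)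
  · obtain ⟨m, rfl⟩ := Nat.exists_eq_add_of_le hi
    rw [hstab]
    exact Finset.le_sup (f := fun i => (tmRun T i).pos.natAbs) (by simp)

theorem exists_injective_apply_eq_zero {A : Type} [Finite A] (a : A) :
    ∃ g : A → ℕ, Function.Injective g ∧ g a = 0 := by
  obtain ⟨f, hf⟩ := Countable.exists_injective_nat A
  exact ⟨fun x => Equiv.swap (f a) 0 (f x), (Equiv.injective _).comp hf, by simp⟩

theorem nth_mk₁ {Γ : Type} [Inhabited Γ] (l : List Γ) (i : ℤ) :
    (Turing.Tape.mk₁ l).nth i = if 0 ≤ i then l.getI i.toNat else default := by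
  split_ifs with h
  · lift i to ℕ using h
    rw [Turing.Tape.mk₁, Turing.Tape.mk₂, Turing.Tape.mk'_nth_nat]
    simp
  · obtain ⟨n, rfl⟩ : ∃ n : ℕ, i = -(n + 1 : ℕ) := ⟨(-i).toNat - 1, by omega⟩
    change (Turing.ListBlank.mk []).nth n = default
    simp [Turing.ListBlank.nth_mk]

/-- For a finitely supported machine `M` there is a table which, once a word has been written on
the tape, uses bounded tape exactly if `M` halts on this word. -/
theorem exists_table_boundTape_iff_eval_dom {Γ Λ : Type} [Inhabited Γ] [Inhabited Λ] [Finite Γ]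
    (M : Turing.TM0.Machine Γ Λ) {S : Set Λ} (hfin : S.Finite) (hS : Turing.TM0.Supports M S) :
    ∃ (s h : ℕ) (g : Γ → ℕ) (T : DTM), ∀ l : List Γ, 2 ≤ l.length →
      (BoundTape (writer s (h :: (l.map g).reverse) ++ T) ↔ (Turing.TM0.eval M l).Dom) := by
  obtain ⟨g, hg, hg0⟩ := exists_injective_apply_eq_zero (some ((default : Γ), false))
  have hfin' : ((Set.univ : Set Phase) ×ˢ S).Finite := Set.finite_univ.prod hfin
  obtain ⟨f, hf⟩ := Set.countable_iff_exists_injOn.1 hfin'.countable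
  obtain ⟨T, hT⟩ := exists_table (fun x => 2 * f x + 1) g hfin'
    (fun x hx y hy hxy => hf hx hy (by simpa using hxy)) hg (simδ M)
  refine ⟨2 * f (.run, default) + 1, g none, fun a => g (some (a, false)), T, fun l hl => ?_⟩
  set e : Phase × Λ → ℕ := fun x => 2 * f x + 1 with he
  set w : List ℕ := g none :: (l.map fun a => g (some (a, false))).reverse with hw
  have hwl : w.length = l.length + 1 := by simp [hw]
  set P : DTM := writer (2 * f (.run, default) + 1) w ++ T with hP
  have hPT : ∀ q ∈ (Set.univ : Set Phase) ×ˢ S, ∀ a,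
      P.find? (fun x => decide (x.1 = (e q, g a))) =
      (simδ M q a).map fun r => ((e q, g a), (e r.1, g r.2.1, r.2.2)) := by
    intro q hq a
    rw [← hT q hq a]
    exact find?_writer_append_odd _ _ _ _ _
  set c₀ := rep (Turing.TM0.init l : Turing.TM0.Cfg Γ Λ) (-l.length) 0 with hc₀
  have hinit : tmRun P (w.length + 1) = encCfg e g c₀ := by
    rw [hP, tmRun_writer_length_succ]
    simp only [encCfg, hc₀, rep, Turing.TM0.init, TMConfig.mk.injEq]
    refine ⟨rfl, ?_, by rw [hwl]; push_cast; ring⟩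
    funext z
    simp only [writtenTape, plainTape, nth_mk₁, hwl]
    by_cases hz0 : z = 0
    · subst hz0
      simp [hw]
      omega
    rw [if_neg hz0]
    by_cases hz : -(l.length : ℤ) ≤ z ∧ z < 0
    · obtain ⟨j, hj, rfl⟩ : ∃ j : ℕ, j < l.length ∧ z = -((j : ℤ) + 1) :=
        ⟨(-z).toNat - 1, by omega, by omega⟩
      rw [if_pos (by push_cast; omega), if_pos (by omega)]
      have h₁ : (- -((j : ℤ) + 1)).toNat = j + 1 := by omega
      have h₂ : (-((j : ℤ) + 1) - -(l.length : ℤ)).toNat = l.length - 1 - j := by omega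
      rw [h₁, h₂, hw, List.getD_cons_succ, List.getI_eq_getElem _ (by omega),
        List.getD_eq_getElem _ _ (by simpa using hj)]
      simp
    · rw [if_neg (by push_cast; omega)]
      split_ifs with h
      · rw [List.getI_eq_default _ (by omega), hg0]
      · exact hg0.symm
  have hc₀S : c₀.1 ∈ (Set.univ : Set Phase) ×ˢ S := ⟨trivial, hS.1⟩
  have hclosed : ∀ c : (Phase × Λ) × (ℤ → Option (Γ × Bool)) × ℤ,
      c.1 ∈ (Set.univ : Set Phase) ×ˢ S → (step (simδ M) c).1 ∈ (Set.univ : Set Phase) ×ˢ S :=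
    fun c hc => ⟨trivial, step_simδ_supports M hS c hc.2⟩
  have hrun : ∀ n, tmRun P (n + (w.length + 1)) = encCfg e g ((step (simδ M))^[n] c₀) := by
    intro n
    rw [tmRun, Function.iterate_add_apply, ← tmRun, hinit]
    exact tmStep_iterate_encCfg hPT hclosed c₀ hc₀S n
  have hp : -(l.length : ℤ) + 2 ≤ 0 := by omega
  have hF : ∀ z : ℤ, 0 ≤ z →
      (Turing.TM0.init l : Turing.TM0.Cfg Γ Λ).Tape.nth (z - -(l.length : ℤ)) = default := by
    intro z hz
    simp only [Turing.TM0.init, nth_mk₁]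
    rw [if_pos (by omega), List.getI_eq_default _ (by omega)]
  have hdom : (Turing.TM0.eval M l).Dom ↔
      (StateTransition.eval (Turing.TM0.step M) (Turing.TM0.init l)).Dom := Iff.rfl
  rw [hdom]
  constructor
  · rintro ⟨K, hK⟩
    by_contra hno
    obtain ⟨m, ⟨n, rfl⟩, hm⟩ := exists_reach_far M hp hF hno K
    have h := hK (n + (w.length + 1))
    rw [hrun] at h
    simp only [encCfg] at h
    rw [← hc₀] at hm
    omega
  · intro h
    obtain ⟨c, hc⟩ := Part.dom_iff_mem.1 h
    obtain ⟨hreach, hhalt⟩ := StateTransition.mem_eval.1 hc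
    obtain ⟨p', k', ⟨n, hn⟩, hpk⟩ := reach_rep_of_reaches M hp hF hreach
    refine boundTape_of_tmStep_eq (n := n + (w.length + 1)) ?_
    have h₁ := hrun (n + 1)
    rw [add_right_comm, tmRun, Function.iterate_succ_apply', ← tmRun,
      Function.iterate_succ_apply', hn, step_rep_of_halted M hpk hhalt] at h₁
    rw [h₁, hrun, hn]

/-! ### Partial recursive functions -/

instance : Finite Turing.PartrecToTM2.K' :=
  Finite.of_injective (β := Fin 4)
    (fun | .main => 0 | .rev => 1 | .aux => 2 | .stack => 3)
    (by intro a b h; cases a <;> cases b <;> simp_all)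

open Turing.PartrecToTM2 in
theorem trNat_two_pow (n : ℕ) : trNat (2 ^ n) = List.replicate n Γ'.bit0 ++ [Γ'.bit1] := by
  have key : ∃ p : PosNum, ((2 ^ n : ℕ) : Num) = Num.pos p ∧
      trPosNum p = List.replicate n Γ'.bit0 ++ [Γ'.bit1] := by
    induction n with
    | zero => exact ⟨1, rfl, rfl⟩
    | succ n ih =>
      obtain ⟨p, hp, hl⟩ := ih
      refine ⟨p.bit0, ?_, ?_⟩
      · rw [pow_succ, mul_two, Nat.cast_add, hp]
        exact congrArg Num.pos (PosNum.bit0_of_bit0 p)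
      · rw [trPosNum, hl]; rfl
  obtain ⟨p, hp, hl⟩ := key
  rw [trNat, hp, trNum, hl]

open Turing.PartrecToTM2 in
theorem tm2_init_eq (c : Turing.ToPartrec.Code) (v : List ℕ) :
    @Turing.TM2.init _ (fun _ : K' => Γ') Λ' (Option Γ') ⟨trNormal c Cont'.halt⟩ _ _
      K'.main (trList v) = init c v := by
  simp only [Turing.TM2.init, init]
  congr 1
  funext k
  cases k <;> rfl

theorem reverse_map_cons_cons_replicate {α β : Type*} (g : α → β) (a b c : α) (n : ℕ) :
    ((a :: b :: List.replicate n c).map g).reverse = List.replicate n (g c) ++ [g b, g a] := by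
  simp

/-- The halting set of a partial recursive function, restricted to powers of two, is decided by
bounded tape use of machines writing a simple word. -/
theorem exists_table_boundTape_iff_dom {f : ℕ →. ℕ} (hf : Partrec f) :
    ∃ (s h x₀ x₁ x₂ : ℕ) (T : DTM), ∀ n,
      BoundTape (writer s (h :: (List.replicate n x₀ ++ [x₁, x₂])) ++ T) ↔ (f (2 ^ n)).Dom := by
  obtain ⟨c, hc⟩ := Turing.ToPartrec.Code.exists_code (Nat.Partrec'.part_iff₁.2 hf)
  let _ : Inhabited Turing.PartrecToTM2.Λ' :=
    ⟨Turing.PartrecToTM2.trNormal c Turing.PartrecToTM2.Cont'.halt⟩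
  have h₂ := Turing.PartrecToTM2.tr_supports c Turing.PartrecToTM2.Cont'.halt
  have h₁ := Turing.TM2to1.tr_supports Turing.PartrecToTM2.tr h₂
  have h₀ := Turing.TM1to0.tr_supports _ h₁
  have : Finite (Turing.TM2to1.Γ' Turing.PartrecToTM2.K' fun _ => Turing.PartrecToTM2.Γ') :=
    inferInstanceAs
      (Finite (Bool × ∀ _ : Turing.PartrecToTM2.K', Option Turing.PartrecToTM2.Γ'))
  obtain ⟨s, h, g, T, hT⟩ :=
    exists_table_boundTape_iff_eval_dom _ (Finset.finite_toSet _) h₀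
  let sym : Bool → Turing.PartrecToTM2.Γ' →
      Turing.TM2to1.Γ' Turing.PartrecToTM2.K' (fun _ => Turing.PartrecToTM2.Γ') := fun b a =>
    (b, Function.update (fun _ => none) Turing.PartrecToTM2.K'.main (some a))
  refine ⟨s, h, g (sym false .bit0), g (sym false .bit1), g (sym true .cons), T, fun n => ?_⟩
  have hr : (Turing.PartrecToTM2.trList [2 ^ n]).reverse =
      .cons :: .bit1 :: List.replicate n .bit0 := by
    simp [Turing.PartrecToTM2.trList, trNat_two_pow]
  have hl : Turing.TM2to1.trInit (Γ := fun _ => Turing.PartrecToTM2.Γ')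
      Turing.PartrecToTM2.K'.main (Turing.PartrecToTM2.trList [2 ^ n]) =
      sym true .cons :: sym false .bit1 :: List.replicate n (sym false .bit0) := by
    unfold Turing.TM2to1.trInit
    rw [hr]
    exact congrArg (fun r => sym true .cons :: sym false .bit1 :: r) List.map_replicate
  have hT' := hT (sym true .cons :: sym false .bit1 :: List.replicate n (sym false .bit0))
    (Nat.le_add_left _ _)
  rw [reverse_map_cons_cons_replicate] at hT'
  rw [hT', ← hl, Turing.TM1to0.tr_eval]
  refine (Turing.TM2to1.tr_eval_dom (M := Turing.PartrecToTM2.tr) _ _).trans ?_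
  have hev := Turing.PartrecToTM2.tr_eval c [2 ^ n]
  have hcv := hc (2 ^ n ::ᵥ List.Vector.nil)
  change (StateTransition.eval (Turing.TM2.step Turing.PartrecToTM2.tr) (Turing.TM2.init _ _)).Dom
    ↔ _
  rw [tm2_init_eq, hev]
  change (c.eval [2 ^ n]).Dom ↔ _
  have : c.eval [2 ^ n] = pure <$> f (2 ^ n) := hcv
  rw [this]
  rfl

theorem primrec_two_pow : Primrec fun n : ℕ => 2 ^ n := by
  refine (Primrec.nat_rec₁ 1 (f := fun _ x => 2 * x)
    (Primrec.nat_double.comp Primrec.snd).to₂).of_eq fun n => ?_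
  induction n with
  | zero => rfl
  | succ n ih => simp only [ih, pow_succ]; ring

theorem computable_writer_append (s h x₀ x₁ x₂ : ℕ) (T : DTM) :
    Computable fun n : ℕ => writer s (h :: (List.replicate n x₀ ++ [x₁, x₂])) ++ T := by
  have hrep : Primrec fun n : ℕ => List.replicate n x₀ :=
    (Primrec.list_map Primrec.list_range (Primrec.const x₀).to₂).of_eq fun n => by
      simp [List.map_const']
  have hword : Primrec fun n : ℕ => h :: (List.replicate n x₀ ++ [x₁, x₂]) :=
    Primrec.list_cons.comp (Primrec.const h)
      (Primrec.list_append.comp hrep (Primrec.const [x₁, x₂]))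
  have hwriter : Primrec (writer s) := by
    refine Primrec.list_append.comp (Primrec.list_map
      (Primrec.list_range.comp Primrec.list_length) ?_) ?_
    · exact Primrec.pair (Primrec.pair (Primrec.nat_double.comp Primrec.snd) (Primrec.const 0))
        (Primrec.pair (Primrec.nat_double.comp (Primrec.succ.comp Primrec.snd))
          (Primrec.pair ((Primrec.list_getD 0).comp Primrec.fst Primrec.snd)
            (Primrec.const false)))
    · exact Primrec.list_cons.comp
        (Primrec.pair (Primrec.pair (Primrec.nat_double.comp Primrec.list_length)
          (Primrec.const 0)) (Primrec.const (s, 0, true))) (Primrec.const [])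
  exact (Primrec.list_append.comp (hwriter.comp hword) (Primrec.const T)).to_comp

/-- There is a partial recursive function that halts on `2 ^ n` exactly if the `n`-th program
halts on input `0`. -/
theorem exists_partrec_two_pow_dom_iff :
    ∃ f : ℕ →. ℕ, Partrec f ∧
      ∀ n, (f (2 ^ n)).Dom ↔ ((Denumerable.ofNat Nat.Partrec.Code n).eval 0).Dom := by
  refine ⟨fun m => (Nat.rfind fun n => Part.some (decide (2 ^ n = m))).bind fun n =>
    (Denumerable.ofNat Nat.Partrec.Code n).eval 0, ?_, fun n => ?_⟩
  · refine Partrec.bind (Partrec.rfind ?_) ?_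
    · have : Primrec₂ fun m n : ℕ => decide (2 ^ n = m) :=
        (Primrec.eq (α := ℕ)).decide.comp (primrec_two_pow.comp Primrec.snd) Primrec.fst
      exact this.to_comp.partrec₂
    · exact Nat.Partrec.Code.eval_part.comp
        ((Computable.ofNat _).comp Computable.snd) (Computable.const 0)
  · have : (Nat.rfind fun k => Part.some (decide (2 ^ k = 2 ^ n))) = Part.some n := by
      refine Part.eq_some_iff.2 (Nat.mem_rfind.2 ⟨by simp, fun {m} hm => ?_⟩)
      simp [hm.ne]
    change ((Nat.rfind fun k => Part.some (decide (2 ^ k = 2 ^ n))).bind _).Dom ↔ _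
    rw [this, Part.bind_some]

end SpaceTM

/-- The problem `BoundTape` is undecidable: no algorithm decides, given (the code of) a
deterministic Turing machine `M`, whether `M` uses only a bounded portion of its tape
when run on the empty input. -/
theorem boundTape_undecidable : ¬ ComputablePred BoundTape := by
  intro hB
  obtain ⟨f, hf, hdom⟩ := SpaceTM.exists_partrec_two_pow_dom_iff
  obtain ⟨s, h, x₀, x₁, x₂, T, hT⟩ := SpaceTM.exists_table_boundTape_iff_dom hf
  refine ComputablePred.halting_problem 0 (ComputablePred.computable_of_manyOneReducible
    ⟨fun c => SpaceTM.writer s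
      (h :: (List.replicate (Encodable.encode c) x₀ ++ [x₁, x₂])) ++ T, ?_, fun c => ?_⟩ hB)
  · exact (SpaceTM.computable_writer_append s h x₀ x₁ x₂ T).comp Computable.encode
  · rw [hT, hdom, Denumerable.ofNat_encode]
end
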